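/- arXiv:1409.2711 — 2 statements merged into one kernel-verified Lean document; each statement's English description precedes it below -/
import Mathlib

section
/- For every n>1, for K_n and M_n as in the defining conditions (KLTL section), and for every HyperCTL* sentence ψ with |ψ|<n: K_n ⊨ ψ if and only if M_n ⊨ ψ. -/
/-- A tree structure: a Kripke structure whose state set is a prefix-closed set of
words over ℕ, with root `[]` as initial state and edges only from a node `τ` to
children `τ ++ [i]`. -/
structure TreeKripke (AP : Type) where
  nodes : Set (List ℕ)
  root_mem : ([] : List ℕ) ∈ nodes
  prefix_closed : ∀ ⦃τ τ' : List ℕ⦄, τ ∈ nodes → τ' <+: τ → τ' ∈ nodes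
  edge : List ℕ → List ℕ → Prop
  edge_mem_l : ∀ ⦃τ τ' : List ℕ⦄, edge τ τ' → τ ∈ nodes
  edge_mem_r : ∀ ⦃τ τ' : List ℕ⦄, edge τ τ' → τ' ∈ nodes
  edge_child : ∀ ⦃τ τ' : List ℕ⦄, edge τ τ' → ∃ i, τ' = τ ++ [i]
  total : ∀ τ ∈ nodes, ∃ τ', edge τ τ'
  V : List ℕ → Set AP

/-- `pa` is an initial path of the tree structure `T`. -/
def TreeKripke.TInit {AP : Type} (T : TreeKripke AP) (pa : ℕ → List ℕ) : Prop :=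
  pa 0 = [] ∧ ∀ i, T.edge (pa i) (pa (i + 1))

/-- A Kripke structure whose states are natural numbers (used to define unwindings,
and hence regular tree structures). -/
structure NKripke (AP : Type) where
  states : Set ℕ
  s0 : ℕ
  s0_mem : s0 ∈ states
  E : ℕ → ℕ → Prop
  E_mem : ∀ ⦃s t⦄, E s t → s ∈ states ∧ t ∈ states
  total : ∀ s ∈ states, ∃ t, E s t
  V : ℕ → Set AP

/-- A tree structure is regular if it is the unwinding of a finite Kripke structure:
its nodes are the finite paths from the initial state (coded by the lists of visited
states), all parent-child pairs are edges, and labels come from the labels of the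
corresponding states. -/
def IsRegularTree {AP : Type} (T : TreeKripke AP) : Prop :=
  ∃ K : NKripke AP, K.states.Finite ∧
    T.nodes = {τ : List ℕ | List.Chain' K.E (K.s0 :: τ)} ∧
    (∀ τ τ', T.edge τ τ' ↔ (τ ∈ T.nodes ∧ τ' ∈ T.nodes ∧ ∃ i, τ' = τ ++ [i])) ∧
    (∀ τ ∈ T.nodes, T.V τ = K.V ((K.s0 :: τ).getLast (List.cons_ne_nil _ _)))
/-- Syntax of HyperCTL* over atomic propositions `AP` and path variables `Var`. -/
inductive HCTLs (AP Var : Type) where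
  | tt : HCTLs AP Var
  | atom : AP → Var → HCTLs AP Var
  | neg : HCTLs AP Var → HCTLs AP Var
  | conj : HCTLs AP Var → HCTLs AP Var → HCTLs AP Var
  | next : HCTLs AP Var → HCTLs AP Var
  | untl : HCTLs AP Var → HCTLs AP Var → HCTLs AP Var
  | ex : Var → HCTLs AP Var → HCTLs AP Var

/-- All atoms `p[x]` use variables from `B` (bound variables), recursively. -/
def HCTLs.closedIn {AP Var : Type} : HCTLs AP Var → Set Var → Prop
  | .tt, _ => True
  | .atom _ x, B => x ∈ B
  | .neg φ, B => φ.closedIn B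
  | .conj φ ψ, B => φ.closedIn B ∧ ψ.closedIn B
  | .next φ, B => φ.closedIn B
  | .untl φ ψ, B => φ.closedIn B ∧ ψ.closedIn B
  | .ex x φ, B => φ.closedIn (insert x B)

/-- A HyperCTL* sentence: every temporal modality is in the scope of a path quantifier
and every atom `p[x]` has `x` bound by a path quantifier. -/
def HCTLs.isSentence {AP Var : Type} : HCTLs AP Var → Prop
  | .tt => True
  | .atom _ _ => False
  | .neg φ => φ.isSentence
  | .conj φ ψ => φ.isSentence ∧ ψ.isSentence
  | .next _ => False
  | .untl _ _ => False
  | .ex x φ => φ.closedIn {x}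

/-- No path quantifiers occur in the formula. -/
def HCTLs.quantFree {AP Var : Type} : HCTLs AP Var → Prop
  | .tt => True
  | .atom _ _ => True
  | .neg φ => φ.quantFree
  | .conj φ ψ => φ.quantFree ∧ ψ.quantFree
  | .next φ => φ.quantFree
  | .untl φ ψ => φ.quantFree ∧ ψ.quantFree
  | .ex _ _ => False

/-- Prenex form: a block of path quantifiers (existential, or universal encoded as
`¬∃¬`) followed by a quantifier-free formula. -/
inductive HCTLs.prenex {AP Var : Type} : HCTLs AP Var → Prop
  | qf {φ : HCTLs AP Var} : φ.quantFree → φ.prenex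
  | exq {x : Var} {φ : HCTLs AP Var} : φ.prenex → (HCTLs.ex x φ).prenex
  | allq {x : Var} {φ : HCTLs AP Var} :
      φ.prenex → (HCTLs.neg (HCTLs.ex x (HCTLs.neg φ))).prenex

/-- A HyperLTL sentence: a HyperCTL* sentence in prenex form. -/
def HCTLs.isHyperLTL {AP Var : Type} (φ : HCTLs AP Var) : Prop :=
  φ.prenex ∧ φ.isSentence

/-- Size of a HyperCTL* formula. -/
def HCTLs.size {AP Var : Type} : HCTLs AP Var → ℕ
  | .tt => 1
  | .atom _ _ => 1
  | .neg φ => φ.size + 1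
  | .conj φ ψ => φ.size + ψ.size + 1
  | .next φ => φ.size + 1
  | .untl φ ψ => φ.size + ψ.size + 1
  | .ex _ φ => φ.size + 1
/-- Satisfaction of HyperCTL* over a tree structure `T` (paths are raw sequences of
nodes). -/
def HCTLs.satT {AP Var : Type} [DecidableEq Var] (T : TreeKripke AP) :
    HCTLs AP Var → (Var → (ℕ → List ℕ)) → Var → ℕ → Prop
  | .tt, _, _, _ => True
  | .atom p x, A, _, i => p ∈ T.V (A x i)
  | .neg φ, A, y, i => ¬ HCTLs.satT T φ A y i
  | .conj φ ψ, A, y, i => HCTLs.satT T φ A y i ∧ HCTLs.satT T ψ A y i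
  | .next φ, A, y, i => HCTLs.satT T φ A y (i + 1)
  | .untl φ ψ, A, y, i => ∃ j, i ≤ j ∧ HCTLs.satT T ψ A y j ∧
      ∀ k, i ≤ k → k < j → HCTLs.satT T φ A y k
  | .ex x φ, A, y, i => ∃ pa, T.TInit pa ∧ (∀ j, j ≤ i → pa j = A y j) ∧
      HCTLs.satT T φ (Function.update A x pa) x i

/-- `T ⊨ φ` for HyperCTL* over a tree structure `T`. -/
def HCTLs.modelsT {AP Var : Type} [DecidableEq Var] (T : TreeKripke AP)
    (φ : HCTLs AP Var) : Prop :=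
  ∃ (A : Var → (ℕ → List ℕ)) (y : Var), (∀ x, T.TInit (A x)) ∧ HCTLs.satT T φ A y 0
/-- An `n`-block: a word in `{p}∅^*` of length at least `n+2`. -/
def IsNBlock (n : ℕ) (b : List Bool) : Prop :=
  n + 2 ≤ b.length ∧ b = true :: List.replicate (b.length - 1) false

/-- Positionwise union of two equal-length words. -/
def join2 (a b : List Bool) : List Bool := List.zipWith (· || ·) a b

/-- `joinUpTo w k = join(w_1, …, w_k)` (for `k ≥ 1`). -/
def joinUpTo (w : ℕ → List Bool) : ℕ → List Bool
  | 0 => []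
  | 1 => w 1
  | (k + 2) => join2 (joinUpTo w (k + 1)) (w (k + 2))

/-- `r` is a sequence of `n+4` `n`-blocks preceded by a nonempty word in `∅^*` of
length at least `n+2`. -/
def BlockRefine (n : ℕ) (r : List Bool) : Prop :=
  ∃ (z : List Bool) (cs : List (List Bool)),
    r = z ++ cs.flatten ∧ z ≠ [] ∧ n + 2 ≤ z.length ∧ (∀ x ∈ z, x = false) ∧
    cs.length = n + 4 ∧ (∀ c ∈ cs, IsNBlock n c)

/-- `w'` is obtained from `j` by replacing the last symbol with `∅` and replacing
each `n`-block of `j` by a sequence of `n+4` `n`-blocks preceded by a nonempty word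
in `∅^*` of length at least `n+2`. -/
def SuccRel (n : ℕ) (j w' : List Bool) : Prop :=
  ∃ (bls rs : List (List Bool)),
    (∀ b ∈ bls, IsNBlock n b) ∧
    j = bls.flatten ++ [true] ∧
    w' = rs.flatten ++ [false] ∧
    bls.length = rs.length ∧
    ∀ pr ∈ List.zip bls rs, pr.2.length = pr.1.length ∧ BlockRefine n pr.2

/-- `⟨w_1, …, w_n⟩` satisfies the `n`-fractal requirement. -/
def FractalReq (n ℓ : ℕ) (w : ℕ → List Bool) : Prop :=
  (∀ k, 1 ≤ k → k ≤ n → (w k).length = ℓ) ∧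
  (∀ k, 1 ≤ k → k ≤ n → ∃ bls : List (List Bool),
      (∀ b ∈ bls, IsNBlock n b) ∧ joinUpTo w k = bls.flatten ++ [true]) ∧
  (∃ bls : List (List Bool),
      (∀ b ∈ bls, IsNBlock n b) ∧ joinUpTo w 1 = bls.flatten ++ [true] ∧
      bls.length = n + 4) ∧
  (∀ k, 1 ≤ k → k < n → SuccRel n (joinUpTo w k) (w (k + 1)))

/-- The defining conditions of the regular tree structure `K_n` (KLTL section),
over `AP = {p}` (modelled by `Unit`), with parameter `ℓ = ℓ_n > 1`. -/
structure KLTLKnData (n : ℕ) (T : TreeKripke Unit) (ℓ : ℕ) where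
  /-- the distinguished successor `η` of the root -/
  eta : List ℕ
  /-- the successors `ξ_1, …, ξ_n` of the root -/
  xi : ℕ → List ℕ
  /-- the words `w_0, …, w_n` of length `ℓ` -/
  w : ℕ → List Bool
  /-- the unique initial path visiting `η` -/
  pEta : ℕ → List ℕ
  /-- the unique initial paths visiting `ξ_1, …, ξ_n` -/
  pXi : ℕ → ℕ → List ℕ
  edge_eta : T.edge [] eta
  edge_xi : ∀ k, 1 ≤ k → k ≤ n → T.edge [] (xi k)
  succ_only : ∀ τ, T.edge [] τ → τ = eta ∨ ∃ k, 1 ≤ k ∧ k ≤ n ∧ τ = xi k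
  eta_ne_xi : ∀ k, 1 ≤ k → k ≤ n → eta ≠ xi k
  xi_inj : ∀ k k', 1 ≤ k → k ≤ n → 1 ≤ k' → k' ≤ n → xi k = xi k' → k = k'
  pEta_init : T.TInit pEta
  pEta_visits : ∃ i, pEta i = eta
  pEta_unique : ∀ pa, T.TInit pa → (∃ i, pa i = eta) → pa = pEta
  pXi_init : ∀ k, 1 ≤ k → k ≤ n → T.TInit (pXi k)
  pXi_visits : ∀ k, 1 ≤ k → k ≤ n → ∃ i, pXi k i = xi k
  pXi_unique : ∀ k, 1 ≤ k → k ≤ n → ∀ pa, T.TInit pa → (∃ i, pa i = xi k) → pa = pXi k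
  w0_len : (w 0).length = ℓ
  fractal : FractalReq n ℓ w
  /-- `w_0` is the dual of `join(w_1, …, w_n)` -/
  w0_dual : w 0 = (joinUpTo w n).map (fun b => !b)
  /-- the trace of `π(η)` is `∅·w_0·{p}^ω` -/
  trace_eta₀ : () ∉ T.V (pEta 0)
  trace_eta₁ : ∀ i, 1 ≤ i → i ≤ ℓ → (() ∈ T.V (pEta i) ↔ (w 0).getD (i - 1) false = true)
  trace_eta₂ : ∀ i, ℓ + 1 ≤ i → () ∈ T.V (pEta i)
  /-- the trace of `π(ξ_k)` is `∅·w_k·∅^ω` -/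
  trace_xi₀ : ∀ k, 1 ≤ k → k ≤ n → () ∉ T.V (pXi k 0)
  trace_xi₁ : ∀ k, 1 ≤ k → k ≤ n → ∀ i, 1 ≤ i → i ≤ ℓ →
      (() ∈ T.V (pXi k i) ↔ (w k).getD (i - 1) false = true)
  trace_xi₂ : ∀ k, 1 ≤ k → k ≤ n → ∀ i, ℓ + 1 ≤ i → () ∉ T.V (pXi k i)

/-- `ia = i_alert`: the third main position (in increasing order) at which `π(ξ_1)`
is labeled `{p}` in `K_n` (equivalently, at which `w_1` carries `true`). -/
def IsAlert (ℓ : ℕ) (w1 : List Bool) (ia : ℕ) : Prop :=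
  1 ≤ ia ∧ ia ≤ ℓ ∧ w1.getD (ia - 1) false = true ∧
  ((Finset.Icc 1 ℓ).filter (fun i => i < ia ∧ w1.getD (i - 1) false = true)).card = 2

/-- `M` is obtained from `K_n` by replacing the label `{p}` of `π(ξ_1)(i_alert)`
with `∅`. -/
def MObtainedKLTL {n ℓ : ℕ} {T : TreeKripke Unit} (M : TreeKripke Unit)
    (D : KLTLKnData n T ℓ) (ia : ℕ) : Prop :=
  M.nodes = T.nodes ∧ M.edge = T.edge ∧
    ∀ τ, M.V τ = if τ = D.pXi 1 ia then ∅ else T.V τ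
/-- Satisfaction along a word of path indices, where `p[x]` holds at `i` iff the `i`-th letter is
the index of `x`, and quantifiers can only copy the current path. -/
def HCTLs.satWord {Var : Type} [DecidableEq Var] (W : ℕ → ℕ) :
    HCTLs Unit Var → (Var → ℕ) → Var → ℕ → Prop
  | .tt, _, _, _ => True
  | .atom _ x, σ, _, i => W i = σ x
  | .neg φ, σ, y, i => ¬ HCTLs.satWord W φ σ y i
  | .conj φ ψ, σ, y, i => HCTLs.satWord W φ σ y i ∧ HCTLs.satWord W ψ σ y i
  | .next φ, σ, y, i => HCTLs.satWord W φ σ y (i + 1)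
  | .untl φ ψ, σ, y, i => ∃ j, i ≤ j ∧ HCTLs.satWord W ψ σ y j ∧
      ∀ k, i ≤ k → k < j → HCTLs.satWord W φ σ y k
  | .ex x φ, σ, y, i => HCTLs.satWord W φ (Function.update σ x (σ y)) x i

theorem HCTLs.size_pos {AP Var : Type} (φ : HCTLs AP Var) : 0 < φ.size := by
  cases φ <;> simp [HCTLs.size]

theorem HCTLs.satWord_add_iff {Var : Type} [DecidableEq Var] {W W' : ℕ → ℕ} {a c : ℕ}
    (hshift : ∀ i, a ≤ i → W' (i + c) = W i) (φ : HCTLs Unit Var) :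
    ∀ σ y i, a ≤ i → (φ.satWord W' σ y (i + c) ↔ φ.satWord W σ y i) := by
  induction φ with
  | tt => intros; rfl
  | atom p x => intro σ y i hi; simp only [satWord, hshift i hi]
  | neg φ ih => intro σ y i hi; simp only [satWord, ih σ y i hi]
  | conj φ ψ ih1 ih2 => intro σ y i hi; simp only [satWord, ih1 σ y i hi, ih2 σ y i hi]
  | next φ ih =>
    intro σ y i hi
    simp only [satWord]
    rw [← ih σ y (i + 1) (by omega), Nat.add_right_comm]
  | untl φ ψ ih1 ih2 =>
    intro σ y i hi
    simp only [satWord]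
    constructor
    · rintro ⟨j, hj, h2, h1⟩
      obtain ⟨j, rfl⟩ : ∃ j', j = j' + c := ⟨j - c, by omega⟩
      refine ⟨j, by omega, (ih2 σ y j (by omega)).1 h2, fun k hk hkj => ?_⟩
      exact (ih1 σ y k (by omega)).1 (h1 (k + c) (by omega) (by omega))
    · rintro ⟨j, hj, h2, h1⟩
      refine ⟨j + c, by omega, (ih2 σ y j (by omega)).2 h2, fun k hk hkj => ?_⟩
      obtain ⟨k, rfl⟩ : ∃ k', k = k' + c := ⟨k - c, by omega⟩
      exact (ih1 σ y k (by omega)).2 (h1 k (by omega) (by omega))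
  | ex x φ ih => intro σ y i hi; exact ih _ _ i hi

/-- Inserting one more copy of a factor of length `c` that is already repeated `m` times from
position `a` on is invisible to formulas of size at most `m`. -/
theorem HCTLs.satWord_iff_of_repetition {Var : Type} [DecidableEq Var] {W W' : ℕ → ℕ}
    {a c m : ℕ} (hc : 0 < c) (heq : ∀ i, i < a + m * c → W i = W' i)
    (hshift : ∀ i, a ≤ i → W' (i + c) = W i) (φ : HCTLs Unit Var) :
    ∀ σ y i, φ.size ≤ m → i + φ.size * c < a + m * c →
      (φ.satWord W σ y i ↔ φ.satWord W' σ y i) := by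
  induction φ with
  | tt => intros; rfl
  | atom p x =>
    intro σ y i _ hi
    simp only [satWord, heq i (by omega)]
  | neg φ ih =>
    intro σ y i hm hi
    simp only [size, add_mul] at hm hi
    simp only [satWord, ih σ y i (by omega) (by omega)]
  | conj φ ψ ih1 ih2 =>
    intro σ y i hm hi
    simp only [size, add_mul] at hm hi
    simp only [satWord, ih1 σ y i (by omega) (by omega), ih2 σ y i (by omega) (by omega)]
  | next φ ih =>
    intro σ y i hm hi
    simp only [size, add_mul] at hm hi
    exact ih σ y (i + 1) (by omega) (by omega)
  | untl φ ψ ih1 ih2 =>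
    intro σ y i hm hi
    simp only [size, add_mul, one_mul] at hm hi
    obtain ⟨q, hq⟩ : ∃ q, m = φ.size + ψ.size + 1 + q := ⟨m - (φ.size + ψ.size + 1), by omega⟩
    have hmc : m * c = φ.size * c + ψ.size * c + c + q * c := by rw [hq]; ring
    -- positions below the threshold `t` correspond to themselves, the others are shifted by `c`
    set t := a + q * c + c with ht
    have hlow1 : ∀ k, k < t → (φ.satWord W σ y k ↔ φ.satWord W' σ y k) :=
      fun k hk => ih1 σ y k (by omega) (by omega)
    have hlow2 : ∀ k, k < t → (ψ.satWord W σ y k ↔ ψ.satWord W' σ y k) :=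
      fun k hk => ih2 σ y k (by omega) (by omega)
    have hit : i < a + q * c := by omega
    have hs1 := satWord_add_iff hshift φ σ y
    have hs2 := satWord_add_iff hshift ψ σ y
    simp only [satWord]
    constructor
    · rintro ⟨j, hj, h2, h1⟩
      by_cases hjt : j < t
      · exact ⟨j, hj, (hlow2 j hjt).1 h2,
          fun k hk hkj => (hlow1 k (by omega)).1 (h1 k hk hkj)⟩
      · refine ⟨j + c, by omega, (hs2 j (by omega)).2 h2, fun k hk hkj => ?_⟩
        by_cases hkt : k < t
        · exact (hlow1 k hkt).1 (h1 k hk (by omega))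
        · obtain ⟨k, rfl⟩ : ∃ k', k = k' + c := ⟨k - c, by omega⟩
          exact (hs1 k (by omega)).2 (h1 k (by omega) (by omega))
    · rintro ⟨j, hj, h2, h1⟩
      by_cases hjt : j < t
      · exact ⟨j, hj, (hlow2 j hjt).2 h2,
          fun k hk hkj => (hlow1 k (by omega)).2 (h1 k hk hkj)⟩
      · obtain ⟨j, rfl⟩ : ∃ j', j = j' + c := ⟨j - c, by omega⟩
        refine ⟨j, by omega, (hs2 j (by omega)).1 h2, fun k hk hkj => ?_⟩
        by_cases hkt : k < t
        · exact (hlow1 k hkt).2 (h1 k hk (by omega))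
        · exact (hs1 k (by omega)).1 (h1 (k + c) (by omega) (by omega))
  | ex x φ ih =>
    intro σ y i hm hi
    simp only [size, add_mul] at hm hi
    exact ih _ _ i (by omega) (by omega)

/-- The infinite word `l · s`. -/
def appendWord : List ℕ → (ℕ → ℕ) → ℕ → ℕ
  | [], s, i => s i
  | a :: _, _, 0 => a
  | _ :: l, s, i + 1 => appendWord l s i

theorem appendWord_append (l l' : List ℕ) (s : ℕ → ℕ) :
    appendWord (l ++ l') s = appendWord l (appendWord l' s) := by
  induction l with
  | nil => rfl
  | cons a l ih =>
    funext i
    cases i with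
    | zero => rfl
    | succ i => exact congrFun ih i

theorem appendWord_of_lt (l : List ℕ) (s : ℕ → ℕ) {i : ℕ} (hi : i < l.length) (d : ℕ) :
    appendWord l s i = l.getD i d := by
  induction l generalizing i with
  | nil => simp at hi
  | cons a l ih =>
    cases i with
    | zero => rfl
    | succ i => simpa [appendWord] using ih (by simpa using hi)

theorem appendWord_add_length (l : List ℕ) (s : ℕ → ℕ) (i : ℕ) :
    appendWord l s (i + l.length) = s i := by
  induction l with
  | nil => rfl
  | cons a l ih => exact ih

/-- Two finite words are interchangeable in every context for formulas of size less than `n`. -/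
def WordEquiv (n : ℕ) (u v : List ℕ) : Prop :=
  ∀ (x : List ℕ) (s : ℕ → ℕ) (Var : Type) [DecidableEq Var] (φ : HCTLs Unit Var) (σ : Var → ℕ)
    (y : Var), φ.size < n →
      (φ.satWord (appendWord (x ++ u) s) σ y 0 ↔ φ.satWord (appendWord (x ++ v) s) σ y 0)

namespace WordEquiv

variable {n : ℕ} {u v u' v' : List ℕ}

theorem refl (n : ℕ) (u : List ℕ) : WordEquiv n u u := fun _ _ _ _ _ _ _ _ => Iff.rfl

theorem symm (h : WordEquiv n u v) : WordEquiv n v u :=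
  fun x s Var _ φ σ y hφ => (h x s Var φ σ y hφ).symm

theorem trans (h : WordEquiv n u v) (h' : WordEquiv n v u') : WordEquiv n u u' :=
  fun x s Var _ φ σ y hφ => (h x s Var φ σ y hφ).trans (h' x s Var φ σ y hφ)

theorem append (h : WordEquiv n u v) (h' : WordEquiv n u' v') :
    WordEquiv n (u ++ u') (v ++ v') := by
  intro x s Var _ φ σ y hφ
  have h1 := h x (appendWord u' s) Var φ σ y hφ
  have h2 := h' (x ++ v) s Var φ σ y hφ
  rw [← appendWord_append, ← appendWord_append] at h1
  rw [← List.append_assoc, ← List.append_assoc]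
  exact h1.trans h2

theorem replicate_succ (hu : u ≠ []) {m : ℕ} (hm : n ≤ m) :
    WordEquiv n (List.replicate m u).flatten (List.replicate (m + 1) u).flatten := by
  intro x s Var _ φ σ y hφ
  have hc : 0 < u.length := List.length_pos_iff.2 hu
  have hlen : (x ++ (List.replicate m u).flatten).length = x.length + m * u.length := by simp
  refine HCTLs.satWord_iff_of_repetition (a := x.length) (m := m) hc ?_ ?_ φ σ y 0 (by omega) ?_
  · intro i hi
    rw [List.replicate_succ', List.flatten_concat, ← List.append_assoc, appendWord_append _ u]
    rw [appendWord_of_lt _ _ (by omega) 0, appendWord_of_lt _ _ (by omega) 0]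
  · intro i hi
    obtain ⟨t, rfl⟩ : ∃ t, i = t + x.length := ⟨i - x.length, by omega⟩
    rw [List.replicate_succ, List.flatten_cons, appendWord_append x, appendWord_append x,
      appendWord_append u, appendWord_add_length, Nat.add_right_comm, appendWord_add_length,
      appendWord_add_length]
  · have := Nat.mul_lt_mul_of_pos_right (show φ.size < m by omega) hc
    omega

theorem replicate (hu : u ≠ []) {m m' : ℕ} (hm : n ≤ m) (hm' : n ≤ m') :
    WordEquiv n (List.replicate m u).flatten (List.replicate m' u).flatten := by
  have key : ∀ k, n ≤ k →
      WordEquiv n (List.replicate n u).flatten (List.replicate k u).flatten := by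
    intro k hk
    induction k, hk using Nat.le_induction with
    | base => exact refl _ _
    | succ k hk ih => exact ih.trans (replicate_succ hu hk)
  exact (key m hm).symm.trans (key m' hm')

theorem replicate_letter (a : ℕ) {m m' : ℕ} (hm : n ≤ m) (hm' : n ≤ m') :
    WordEquiv n (List.replicate m a) (List.replicate m' a) := by
  have h := replicate (n := n) (u := [a]) (by simp) hm hm'
  have hr : ∀ k, (List.replicate k [a]).flatten = List.replicate k a := by
    intro k
    induction k with
    | zero => rfl
    | succ k ih => simp [List.replicate_succ, ih]
  rwa [hr, hr] at h

end WordEquiv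

/-- The word with block heads `l`, all blocks having the shortest allowed length. -/
def blockWord (n : ℕ) (l : List ℕ) : List ℕ := l.flatMap fun a => a :: List.replicate (n + 1) 0

/-- Refinement of the sequence of block heads when passing to level `k`. -/
def refineHeads (n k : ℕ) (l : List ℕ) : List ℕ :=
  l.flatMap fun a => a :: List.replicate (n + 4) k

/-- The sequence of block heads refined through levels `k + 1, …, k + r`. -/
def refineHeadsIter (n : ℕ) : ℕ → ℕ → List ℕ → List ℕ
  | _, 0, l => l
  | k, r + 1, l => refineHeadsIter n (k + 1) r (refineHeads n (k + 1) l)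

theorem refineHeadsIter_append (n k r : ℕ) (l l' : List ℕ) :
    refineHeadsIter n k r (l ++ l') = refineHeadsIter n k r l ++ refineHeadsIter n k r l' := by
  induction r generalizing k l l' with
  | zero => rfl
  | succ r ih => simp [refineHeadsIter, refineHeads, ← ih]

theorem refineHeadsIter_nil (n k r : ℕ) : refineHeadsIter n k r [] = [] := by
  induction r generalizing k with
  | zero => rfl
  | succ r ih => simpa [refineHeadsIter, refineHeads] using ih (k + 1)

/-- Only the first head of a refined head depends on that head. -/
theorem exists_refineHeadsIter_singleton (n k r : ℕ) :
    ∃ t : List ℕ, (∀ b ∈ t, k < b) ∧ ∀ a, refineHeadsIter n k r [a] = a :: t := by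
  induction r generalizing k with
  | zero => exact ⟨[], by simp, fun a => rfl⟩
  | succ r ih =>
    obtain ⟨t, ht, hta⟩ := ih (k + 1)
    have hrep : ∀ q, ∀ b ∈ refineHeadsIter n (k + 1) r (List.replicate q (k + 1)), k < b := by
      intro q
      induction q with
      | zero => simp [refineHeadsIter_nil]
      | succ q ihq =>
        intro b hb
        rw [List.replicate_succ, ← List.singleton_append, refineHeadsIter_append, hta] at hb
        simp only [List.cons_append, List.mem_cons, List.mem_append] at hb
        rcases hb with rfl | hb | hb
        · omega
        · have := ht b hb; omega
        · exact ihq b hb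
    refine ⟨t ++ refineHeadsIter n (k + 1) r (List.replicate (n + 4) (k + 1)), ?_, fun a => ?_⟩
    · intro b hb
      rcases List.mem_append.1 hb with hb | hb
      · have := ht b hb; omega
      · exact hrep _ b hb
    · have : refineHeads n (k + 1) [a] = [a] ++ List.replicate (n + 4) (k + 1) := by
        simp [refineHeads]
      rw [refineHeadsIter, this, refineHeadsIter_append, hta, List.cons_append]

/-- The canonical word of a head sequence of level `k`. -/
def levelWord (n k r : ℕ) (l : List ℕ) : List ℕ := blockWord n (refineHeadsIter n k r l)

theorem levelWord_append (n k r : ℕ) (l l' : List ℕ) :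
    levelWord n k r (l ++ l') = levelWord n k r l ++ levelWord n k r l' := by
  simp [levelWord, refineHeadsIter_append, blockWord]

theorem levelWord_replicate (n k r a m : ℕ) :
    levelWord n k r (List.replicate m a) = (List.replicate m (levelWord n k r [a])).flatten := by
  induction m with
  | zero => simp [levelWord, refineHeadsIter_nil, blockWord]
  | succ m ih =>
    rw [List.replicate_succ, ← List.singleton_append, levelWord_append, ih, List.replicate_succ,
      List.flatten_cons]

theorem levelWord_singleton_ne_nil (n k r a : ℕ) : levelWord n k r [a] ≠ [] := by
  obtain ⟨t, -, ht⟩ := exists_refineHeadsIter_singleton n k r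
  simp [levelWord, ht, blockWord]

theorem levelWord_replicate_equiv (n k r a : ℕ) {m m' : ℕ} (hm : n ≤ m) (hm' : n ≤ m') :
    WordEquiv n (levelWord n k r (List.replicate m a)) (levelWord n k r (List.replicate m' a)) := by
  rw [levelWord_replicate, levelWord_replicate]
  exact WordEquiv.replicate (levelWord_singleton_ne_nil n k r a) hm hm'

/-- A block headed by the hidden letter `h` is absorbed by the block preceding it. -/
theorem levelWord_absorb {n h : ℕ} (r : ℕ) : ∀ k, k + r = n → (h = 0 ∨ (k < h ∧ h ≤ n)) → ∀ a,
    WordEquiv n (levelWord n k r [a, h]) (levelWord n k r [a]) := by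
  induction r with
  | zero =>
    intro k hk hh a
    obtain rfl : h = 0 := by omega
    have h1 : levelWord n k 0 [a, 0] = [a] ++ List.replicate (n + 1 + (n + 2)) 0 := by
      rw [List.replicate_add]
      simp [levelWord, refineHeadsIter, blockWord, List.replicate_succ]
    have h2 : levelWord n k 0 [a] = [a] ++ List.replicate (n + 1) 0 := by
      simp [levelWord, refineHeadsIter, blockWord]
    rw [h1, h2]
    exact (WordEquiv.refl n _).append (WordEquiv.replicate_letter 0 (by omega) (by omega))
  | succ r ih =>
    intro k hk hh a
    have e : ∀ l, levelWord n k (r + 1) l = levelWord n (k + 1) r (refineHeads n (k + 1) l) :=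
      fun l => rfl
    have h2 : refineHeads n (k + 1) [a] = [a] ++ List.replicate (n + 4) (k + 1) := by
      simp [refineHeads]
    rw [e, e, h2, levelWord_append]
    by_cases hk1 : h = k + 1
    · have h1 : refineHeads n (k + 1) [a, h] =
          [a] ++ List.replicate (n + 4 + (1 + (n + 4))) (k + 1) := by
        rw [List.replicate_add (n + 4), List.replicate_add 1]
        simp [refineHeads, hk1]
      rw [h1, levelWord_append]
      exact (WordEquiv.refl n _).append
        (levelWord_replicate_equiv n _ _ _ (by omega) (by omega))
    · have h1 : refineHeads n (k + 1) [a, h] =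
          [a] ++ (List.replicate (n + 3) (k + 1) ++
            ([k + 1, h] ++ List.replicate (n + 4) (k + 1))) := by
        have : List.replicate (n + 4) (k + 1) = List.replicate (n + 3) (k + 1) ++ [k + 1] :=
          List.replicate_succ'
        simp [refineHeads, this]
      have h3 : levelWord n (k + 1) r (List.replicate (n + 3 + (1 + (n + 4))) (k + 1)) =
          levelWord n (k + 1) r (List.replicate (n + 3) (k + 1)) ++
            (levelWord n (k + 1) r [k + 1] ++
              levelWord n (k + 1) r (List.replicate (n + 4) (k + 1))) := by
        rw [List.replicate_add (n + 3), List.replicate_add 1, levelWord_append, levelWord_append]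
        rfl
      rw [h1, levelWord_append, levelWord_append, levelWord_append]
      refine (WordEquiv.refl n _).append (WordEquiv.trans (v := levelWord n (k + 1) r
        (List.replicate (n + 3 + (1 + (n + 4))) (k + 1))) ?_
        (levelWord_replicate_equiv n _ _ _ (by omega) (by omega)))
      rw [h3]
      exact (WordEquiv.refl n _).append
        ((ih (k + 1) (by omega) (by omega) _).append (WordEquiv.refl n _))

theorem levelWord_alert_equiv {n h : ℕ} (hn : 1 < n) (hh : h = 0 ∨ (1 < h ∧ h ≤ n)) :
    WordEquiv n (levelWord n 1 (n - 1) (List.replicate (n + 4) 1))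
      (levelWord n 1 (n - 1) ([1, 1] ++ h :: List.replicate (n + 1) 1)) := by
  have h1 : levelWord n 1 (n - 1) ([1, 1] ++ h :: List.replicate (n + 1) 1) =
      levelWord n 1 (n - 1) [1] ++ (levelWord n 1 (n - 1) [1, h] ++
        levelWord n 1 (n - 1) (List.replicate (n + 1) 1)) := by
    rw [← levelWord_append, ← levelWord_append]
    rfl
  have h2 : levelWord n 1 (n - 1) (List.replicate (1 + (1 + (n + 1))) 1) =
      levelWord n 1 (n - 1) [1] ++ (levelWord n 1 (n - 1) [1] ++
        levelWord n 1 (n - 1) (List.replicate (n + 1) 1)) := by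
    rw [List.replicate_add, List.replicate_add, levelWord_append, levelWord_append]
    rfl
  refine (levelWord_replicate_equiv n 1 (n - 1) 1 (m' := 1 + (1 + (n + 1)))
    (by omega) (by omega)).trans ?_
  rw [h1, h2]
  exact (WordEquiv.refl n _).append
    ((levelWord_absorb (n - 1) 1 (by omega) hh 1).symm.append (WordEquiv.refl n _))

namespace TreeKripke

variable {AP : Type} {T : TreeKripke AP} {pa pb : ℕ → List ℕ}

theorem TInit.length_eq (h : T.TInit pa) (i : ℕ) : (pa i).length = i := by
  induction i with
  | zero => simp [h.1]
  | succ i ih =>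
    obtain ⟨c, hc⟩ := T.edge_child (h.2 i)
    simp [hc, ih]

theorem TInit.eq_of_le (ha : T.TInit pa) (hb : T.TInit pb) {i j : ℕ} (hji : j ≤ i)
    (h : pa i = pb i) : pa j = pb j := by
  induction i, hji using Nat.le_induction with
  | base => exact h
  | succ i _ ih =>
    obtain ⟨c, hc⟩ := T.edge_child (ha.2 i)
    obtain ⟨d, hd⟩ := T.edge_child (hb.2 i)
    rw [hc, hd] at h
    exact ih (List.append_inj_left h (by rw [ha.length_eq, hb.length_eq]))

end TreeKripke

namespace KLTLKnData

variable {n ℓ : ℕ} {T : TreeKripke Unit} (D : KLTLKnData n T ℓ)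

/-- The initial paths `π(η), π(ξ_1), …, π(ξ_n)`, indexed from `0`. -/
def path (j : ℕ) : ℕ → List ℕ := if j = 0 then D.pEta else D.pXi j

theorem path_zero : D.path 0 = D.pEta := rfl

theorem path_of_pos {j : ℕ} (hj : 1 ≤ j) : D.path j = D.pXi j := if_neg (by omega)

theorem path_init {j : ℕ} (hj : j ≤ n) : T.TInit (D.path j) := by
  rcases Nat.eq_zero_or_pos j with rfl | h
  · exact D.pEta_init
  · rw [D.path_of_pos h]; exact D.pXi_init j h hj

theorem eq_one_of_edge_root {pa : ℕ → List ℕ} (hpa : T.TInit pa) {τ : List ℕ}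
    (hτ : T.edge [] τ) (h : ∃ i, pa i = τ) : pa 1 = τ := by
  obtain ⟨i, rfl⟩ := h
  obtain ⟨c, hc⟩ := T.edge_child hτ
  have := hpa.length_eq i
  rw [hc] at this
  obtain rfl : 1 = i := by simpa using this
  rfl

theorem pEta_one : D.pEta 1 = D.eta :=
  eq_one_of_edge_root D.pEta_init D.edge_eta D.pEta_visits

theorem pXi_one {k : ℕ} (h1 : 1 ≤ k) (hk : k ≤ n) : D.pXi k 1 = D.xi k :=
  eq_one_of_edge_root (D.pXi_init k h1 hk) (D.edge_xi k h1 hk) (D.pXi_visits k h1 hk)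

theorem exists_eq_path {pa : ℕ → List ℕ} (hpa : T.TInit pa) : ∃ j ≤ n, pa = D.path j := by
  have h1 : T.edge [] (pa 1) := by simpa [hpa.1] using hpa.2 0
  rcases D.succ_only _ h1 with h | ⟨k, hk1, hk, h⟩
  · exact ⟨0, Nat.zero_le _, D.pEta_unique pa hpa ⟨1, h⟩⟩
  · exact ⟨k, hk, by rw [D.path_of_pos hk1]; exact D.pXi_unique k hk1 hk pa hpa ⟨1, h⟩⟩

theorem path_injective {j j' i : ℕ} (hj : j ≤ n) (hj' : j' ≤ n) (hi : 1 ≤ i)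
    (h : D.path j i = D.path j' i) : j = j' := by
  have h1 := (D.path_init hj).eq_of_le (D.path_init hj') hi h
  rcases Nat.eq_zero_or_pos j with rfl | hp <;> rcases Nat.eq_zero_or_pos j' with rfl | hp'
  · rfl
  · rw [path_zero, D.path_of_pos hp', D.pEta_one, D.pXi_one hp' hj'] at h1
    exact absurd h1 (D.eta_ne_xi j' hp' hj')
  · rw [path_zero, D.path_of_pos hp, D.pEta_one, D.pXi_one hp hj] at h1
    exact absurd h1.symm (D.eta_ne_xi j hp hj)
  · rw [D.path_of_pos hp, D.path_of_pos hp', D.pXi_one hp hj, D.pXi_one hp' hj'] at h1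
    exact D.xi_inj j j' hp hj hp' hj' h1

theorem path_eq_of_agree {pa : ℕ → List ℕ} (hpa : T.TInit pa) {j i : ℕ} (hj : j ≤ n)
    (hi : 1 ≤ i) (h : pa i = D.path j i) : pa = D.path j := by
  obtain ⟨j', hj', rfl⟩ := D.exists_eq_path hpa
  rw [D.path_injective hj' hj hi h]

end KLTLKnData

/-- Beyond the root, the initial paths `path 0, …, path n` of `S` are determined by any of their
nodes, and their labels, apart from those of `path h`, are read off from the word `L`. -/
structure ReadsWord (S : TreeKripke Unit) (path : ℕ → ℕ → List ℕ) (n h : ℕ) (L : ℕ → ℕ) :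
    Prop where
  init : ∀ j ≤ n, S.TInit (path j)
  eq_path : ∀ pa, S.TInit pa → ∀ j ≤ n, ∀ i, 1 ≤ i → pa i = path j i → pa = path j
  label : ∀ j ≤ n, j ≠ h → ∀ i, () ∈ S.V (path j (i + 1)) ↔ L i = j

theorem ReadsWord.satT_iff_satWord {S : TreeKripke Unit} {path : ℕ → ℕ → List ℕ} {n h : ℕ}
    {L : ℕ → ℕ} (hS : ReadsWord S path n h L) {Var : Type} [DecidableEq Var]
    (φ : HCTLs Unit Var) : ∀ (B : Set Var) (A : Var → ℕ → List ℕ) (σ : Var → ℕ) (y : Var) (i : ℕ),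
      φ.closedIn B → y ∈ B → (∀ x ∈ B, A x = path (σ x) ∧ σ x ≤ n ∧ σ x ≠ h) →
      (φ.satT S A y (i + 1) ↔ φ.satWord L σ y i) := by
  induction φ with
  | tt => intros; rfl
  | atom p x =>
    intro B A σ y i hB _ hA
    obtain ⟨h1, h2, h3⟩ := hA x hB
    simp only [HCTLs.satT, HCTLs.satWord, h1]
    exact hS.label _ h2 h3 i
  | neg φ ih =>
    intro B A σ y i hB hy hA
    exact not_congr (ih B A σ y i hB hy hA)
  | conj φ ψ ih1 ih2 =>
    intro B A σ y i hB hy hA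
    exact and_congr (ih1 B A σ y i hB.1 hy hA) (ih2 B A σ y i hB.2 hy hA)
  | next φ ih =>
    intro B A σ y i hB hy hA
    exact ih B A σ y (i + 1) hB hy hA
  | untl φ ψ ih1 ih2 =>
    intro B A σ y i hB hy hA
    have e1 := fun i => ih1 B A σ y i hB.1 hy hA
    have e2 := fun i => ih2 B A σ y i hB.2 hy hA
    simp only [HCTLs.satT, HCTLs.satWord]
    constructor
    · rintro ⟨j, hj, h2, h1⟩
      obtain ⟨j, rfl⟩ : ∃ j', j = j' + 1 := ⟨j - 1, by omega⟩
      exact ⟨j, by omega, (e2 j).1 h2,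
        fun k hk hkj => (e1 k).1 (h1 (k + 1) (by omega) (by omega))⟩
    · rintro ⟨j, hj, h2, h1⟩
      refine ⟨j + 1, by omega, (e2 j).2 h2, fun k hk hkj => ?_⟩
      obtain ⟨k, rfl⟩ : ∃ k', k = k' + 1 := ⟨k - 1, by omega⟩
      exact (e1 k).2 (h1 k (by omega) (by omega))
  | ex x φ ih =>
    intro B A σ y i hB hy hA
    obtain ⟨hAy, hyn, hyh⟩ := hA y hy
    have key : φ.satT S (Function.update A x (A y)) x (i + 1) ↔
        φ.satWord L (Function.update σ x (σ y)) x i := by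
      refine ih (insert x B) _ _ x i hB (Set.mem_insert _ _) fun z hz => ?_
      by_cases hzx : z = x
      · subst hzx; simp [hAy, hyn, hyh]
      · simpa [hzx] using hA z (hz.resolve_left hzx)
    simp only [HCTLs.satT, HCTLs.satWord, ← key]
    constructor
    · rintro ⟨pa, hpa, hagree, h⟩
      have := hagree (i + 1) le_rfl
      rw [hAy] at this
      rwa [hS.eq_path pa hpa _ hyn _ (by omega) this, ← hAy] at h
    · intro h
      exact ⟨A y, by rw [hAy]; exact hS.init _ hyn, fun _ _ => rfl, h⟩

theorem HCTLs.satT_untl_zero_iff {AP Var : Type} [DecidableEq Var] (T : TreeKripke AP)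
    (φ ψ : HCTLs AP Var) (A : Var → ℕ → List ℕ) (y : Var) :
    (HCTLs.untl φ ψ).satT T A y 0 ↔
      ψ.satT T A y 0 ∨ (φ.satT T A y 0 ∧ (HCTLs.untl φ ψ).satT T A y 1) := by
  simp only [satT]
  constructor
  · rintro ⟨j, -, h2, h1⟩
    rcases Nat.eq_zero_or_pos j with rfl | hj
    · exact Or.inl h2
    · exact Or.inr ⟨h1 0 le_rfl hj, j, hj, h2, fun k _ hkj => h1 k (Nat.zero_le _) hkj⟩
  · rintro (h | ⟨h0, j, hj, h2, h1⟩)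
    · exact ⟨0, le_rfl, h, fun k _ hk => absurd hk (Nat.not_lt_zero _)⟩
    · refine ⟨j, Nat.zero_le _, h2, fun k _ hkj => ?_⟩
      rcases Nat.eq_zero_or_pos k with rfl | hk
      · exact h0
      · exact h1 k hk hkj

/-- Two tree structures over the same `n + 1` initial paths agree on small formulas at the root if
hiding any one path makes the words of labels indistinguishable. -/
theorem satT_zero_iff_of_readsWord {T M : TreeKripke Unit} {path : ℕ → ℕ → List ℕ} {n : ℕ}
    {Var : Type} [DecidableEq Var] (hTM : ∀ pa, M.TInit pa ↔ T.TInit pa)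
    (hTroot : () ∉ T.V []) (hMroot : () ∉ M.V [])
    (hex : ∀ pa, T.TInit pa → ∃ j ≤ n, pa = path j)
    (hread : ∀ h ≤ n, ∃ L L', ReadsWord T path n h L ∧ ReadsWord M path n h L' ∧
      ∀ (φ : HCTLs Unit Var) (σ : Var → ℕ) (y : Var), φ.size < n →
        (φ.satWord L σ y 0 ↔ φ.satWord L' σ y 0))
    (φ : HCTLs Unit Var) : ∀ (B : Set Var) (A : Var → ℕ → List ℕ) (σ : Var → ℕ) (y : Var)
      (I : Finset ℕ), φ.closedIn B → y ∈ B → (∀ x ∈ B, A x = path (σ x) ∧ σ x ∈ I) →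
      I ⊆ Finset.range (n + 1) → I.card + φ.size ≤ n →
      (φ.satT T A y 0 ↔ φ.satT M A y 0) := by
  have hinit : ∀ j ≤ n, T.TInit (path j) := fun j hj => by
    obtain ⟨L, _, hL, _⟩ := hread 0 (Nat.zero_le _)
    exact hL.init j hj
  have hone : ∀ (φ : HCTLs Unit Var) (B : Set Var) (A : Var → ℕ → List ℕ) (σ : Var → ℕ) (y : Var)
      (I : Finset ℕ), φ.closedIn B → y ∈ B → (∀ x ∈ B, A x = path (σ x) ∧ σ x ∈ I) →
      I ⊆ Finset.range (n + 1) → I.card + φ.size ≤ n →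
      (φ.satT T A y 1 ↔ φ.satT M A y 1) := by
    intro φ B A σ y I hB hy hA hI hcard
    have hφ := φ.size_pos
    obtain ⟨h, hh, hhI⟩ : ∃ h ∈ Finset.range (n + 1), h ∉ I :=
      Finset.exists_mem_notMem_of_card_lt_card (by rw [Finset.card_range]; omega)
    have hIpos : 0 < I.card := Finset.card_pos.2 ⟨_, (hA y hy).2⟩
    obtain ⟨L, L', hL, hL', heq⟩ := hread h (by simpa [Nat.lt_succ_iff] using hh)
    have hA' : ∀ x ∈ B, A x = path (σ x) ∧ σ x ≤ n ∧ σ x ≠ h := fun x hx => by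
      obtain ⟨h1, h2⟩ := hA x hx
      refine ⟨h1, ?_, fun h3 => hhI (h3 ▸ h2)⟩
      simpa [Nat.lt_succ_iff] using hI h2
    rw [show (1 : ℕ) = 0 + 1 from rfl, hL.satT_iff_satWord φ B A σ y 0 hB hy hA',
      hL'.satT_iff_satWord φ B A σ y 0 hB hy hA']
    exact heq φ σ y (by omega)
  induction φ with
  | tt => intros; rfl
  | atom p x =>
    intro B A σ y I hB _ hA hI _
    obtain ⟨h1, h2⟩ := hA x hB
    have h0 : A x 0 = [] := by
      rw [h1]; exact (hinit _ (by simpa [Nat.lt_succ_iff] using hI h2)).1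
    simp only [HCTLs.satT, h0]
    exact iff_of_false hTroot hMroot
  | neg φ ih =>
    intro B A σ y I hB hy hA hI hc
    simp only [HCTLs.size] at hc
    exact not_congr (ih B A σ y I hB hy hA hI (by omega))
  | conj φ ψ ih1 ih2 =>
    intro B A σ y I hB hy hA hI hc
    simp only [HCTLs.size] at hc
    exact and_congr (ih1 B A σ y I hB.1 hy hA hI (by omega))
      (ih2 B A σ y I hB.2 hy hA hI (by omega))
  | next φ ih =>
    intro B A σ y I hB hy hA hI hc
    simp only [HCTLs.size] at hc
    exact hone φ B A σ y I hB hy hA hI (by omega)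
  | untl φ ψ ih1 ih2 =>
    intro B A σ y I hB hy hA hI hc
    rw [HCTLs.satT_untl_zero_iff, HCTLs.satT_untl_zero_iff,
      hone (.untl φ ψ) B A σ y I hB hy hA hI hc]
    simp only [HCTLs.size] at hc
    rw [ih1 B A σ y I hB.1 hy hA hI (by omega), ih2 B A σ y I hB.2 hy hA hI (by omega)]
  | ex x φ ih =>
    intro B A σ y I hB hy hA hI hc
    simp only [HCTLs.size] at hc
    simp only [HCTLs.satT]
    refine exists_congr fun pa => ?_
    rw [hTM]
    refine and_congr_right fun hpa => and_congr_right fun _ => ?_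
    obtain ⟨j, hj, rfl⟩ := hex pa hpa
    have := Finset.card_insert_le j I
    refine ih (insert x B) _ (Function.update σ x j) x (insert j I) hB (Set.mem_insert _ _)
      (fun z hz => ?_) ?_ (by omega)
    · by_cases hzx : z = x
      · subst hzx; simp
      · have := hA z (hz.resolve_left hzx)
        simp [hzx, this.1, this.2]
    · exact Finset.insert_subset (by simpa [Nat.lt_succ_iff] using hj) hI

theorem satT_zero_iff_of_isSentence {T M : TreeKripke Unit} {path : ℕ → ℕ → List ℕ} {n : ℕ}
    {Var : Type} [DecidableEq Var] (hTM : ∀ pa, M.TInit pa ↔ T.TInit pa)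
    (hex : ∀ pa, T.TInit pa → ∃ j ≤ n, pa = path j)
    (hsat : ∀ (φ : HCTLs Unit Var) (B : Set Var) (A : Var → ℕ → List ℕ) (σ : Var → ℕ) (y : Var)
      (I : Finset ℕ), φ.closedIn B → y ∈ B → (∀ x ∈ B, A x = path (σ x) ∧ σ x ∈ I) →
      I ⊆ Finset.range (n + 1) → I.card + φ.size ≤ n → (φ.satT T A y 0 ↔ φ.satT M A y 0))
    (ψ : HCTLs Unit Var) (A : Var → ℕ → List ℕ) (y : Var) (hψ : ψ.isSentence)
    (hsize : ψ.size < n) : ψ.satT T A y 0 ↔ ψ.satT M A y 0 := by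
  induction ψ with
  | tt => rfl
  | atom p x => exact hψ.elim
  | neg φ ih =>
    simp only [HCTLs.size] at hsize
    exact not_congr (ih hψ (by omega))
  | conj φ ψ ih1 ih2 =>
    simp only [HCTLs.size] at hsize
    exact and_congr (ih1 hψ.1 (by omega)) (ih2 hψ.2 (by omega))
  | next φ _ => exact hψ.elim
  | untl φ ψ _ _ => exact hψ.elim
  | ex x φ _ =>
    simp only [HCTLs.size] at hsize
    simp only [HCTLs.satT]
    refine exists_congr fun pa => ?_
    rw [hTM]
    refine and_congr_right fun hpa => and_congr_right fun _ => ?_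
    obtain ⟨j, hj, rfl⟩ := hex pa hpa
    refine hsat φ {x} _ (fun _ => j) x {j} hψ rfl (fun z hz => ?_)
      (by simpa [Nat.lt_succ_iff] using hj) (by simp; omega)
    obtain rfl : z = x := hz
    simp

/-- The word of a list of blocks, each given by its head and its number of trailing zeros. -/
def blocksWord (bs : List (ℕ × ℕ)) : List ℕ := bs.flatMap fun b => b.1 :: List.replicate b.2 0

theorem blocksWord_cons (b : ℕ × ℕ) (bs : List (ℕ × ℕ)) :
    blocksWord (b :: bs) = b.1 :: List.replicate b.2 0 ++ blocksWord bs := rfl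

theorem blocksWord_append (bs bs' : List (ℕ × ℕ)) :
    blocksWord (bs ++ bs') = blocksWord bs ++ blocksWord bs' := by
  simp [blocksWord]

theorem blocksWord_equiv {n : ℕ} (bs : List (ℕ × ℕ)) (hbs : ∀ b ∈ bs, n + 1 ≤ b.2) :
    WordEquiv n (blocksWord bs) (blockWord n (bs.map Prod.fst)) := by
  induction bs with
  | nil => exact WordEquiv.refl n _
  | cons b bs ih =>
    have h := ((WordEquiv.refl n [b.1]).append
      (WordEquiv.replicate_letter 0 (m := b.2) (m' := n + 1)
        (by have := hbs b (by simp); omega) (by omega))).append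
      (ih fun b' hb' => hbs b' (by simp [hb']))
    simpa [blocksWord, blockWord] using h

theorem count_blocksWord {a : ℕ} (ha : a ≠ 0) (bs : List (ℕ × ℕ)) :
    (blocksWord bs).count a = (bs.map Prod.fst).count a := by
  induction bs with
  | nil => rfl
  | cons b bs ih =>
    simp [blocksWord_cons, List.count_cons, List.count_replicate, ih, ha.symm]

theorem replicate_false_append_true_inj {m m' : ℕ} {l l' : List Bool}
    (h : List.replicate m false ++ true :: l = List.replicate m' false ++ true :: l') :
    m = m' ∧ l = l' := by
  induction m generalizing m' with
  | zero => cases m' <;> simp_all [List.replicate_succ]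
  | succ m ih =>
    cases m' with
    | zero => simp [List.replicate_succ] at h
    | succ m' =>
      simp only [List.replicate_succ, List.cons_append, List.cons.injEq, true_and] at h
      exact ⟨congrArg _ (ih h).1, (ih h).2⟩

theorem exists_flatten_append_true {bls : List (List Bool)}
    (h : ∀ b ∈ bls, b = true :: List.replicate (b.length - 1) false) :
    ∃ l, bls.flatten ++ [true] = true :: l := by
  cases bls with
  | nil => exact ⟨[], rfl⟩
  | cons b bls =>
    rw [h b (by simp)]
    exact ⟨_, rfl⟩

/-- The decomposition of a word into blocks followed by a final `true` is unique. -/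
theorem blocks_unique {bls bls' : List (List Bool)}
    (h : ∀ b ∈ bls, b = true :: List.replicate (b.length - 1) false)
    (h' : ∀ b ∈ bls', b = true :: List.replicate (b.length - 1) false)
    (heq : bls.flatten ++ [true] = bls'.flatten ++ [true]) : bls = bls' := by
  induction bls generalizing bls' with
  | nil =>
    cases bls' with
    | nil => rfl
    | cons b bls' =>
      rw [h' b (by simp)] at heq
      simp at heq
  | cons b bls ih =>
    cases bls' with
    | nil =>
      rw [h b (by simp)] at heq
      simp at heq
    | cons b' bls' =>
      have hb := h b (by simp)
      have hb' := h' b' (by simp)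
      have ht : ∀ c ∈ bls, c = true :: List.replicate (c.length - 1) false :=
        fun c hc => h c (by simp [hc])
      have ht' : ∀ c ∈ bls', c = true :: List.replicate (c.length - 1) false :=
        fun c hc => h' c (by simp [hc])
      obtain ⟨l, hl⟩ := exists_flatten_append_true ht
      obtain ⟨l', hl'⟩ := exists_flatten_append_true ht'
      rw [List.flatten_cons, List.flatten_cons, List.append_assoc, List.append_assoc, hl, hl',
        hb, hb', List.cons_append, List.cons_append, List.cons.injEq] at heq
      obtain ⟨hlen, hll⟩ := replicate_false_append_true_inj heq.2
      rw [ih ht ht' (by rw [hl, hl', hll]), hb, hb', hlen]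

/-- `q` merges the word `r` into the letter word `l` of level `k`, as the letter `k + 1`. -/
structure IsMerge (k : ℕ) (l : List ℕ) (r : List Bool) (q : List ℕ) : Prop where
  old : ∀ j, 1 ≤ j → j ≤ k → q.map (· == j) = l.map (· == j)
  new : q.map (· == k + 1) = r
  join : q.map (· != 0) = join2 (l.map (· != 0)) r

theorem IsMerge.append {k : ℕ} {l l' q q' : List ℕ} {r r' : List Bool} (h : IsMerge k l r q)
    (h' : IsMerge k l' r' q') (hlen : r.length = l.length) :
    IsMerge k (l ++ l') (r ++ r') (q ++ q') where
  old j h1 h2 := by rw [List.map_append, List.map_append, h.old j h1 h2, h'.old j h1 h2]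
  new := by rw [List.map_append, h.new, h'.new]
  join := by
    rw [List.map_append, List.map_append, h.join, h'.join, join2, join2, join2,
      List.zipWith_append (by simp [hlen])]

theorem isMerge_replicate_zero {n k : ℕ} (cs : List (List Bool)) (hcs : ∀ c ∈ cs, IsNBlock n c) :
    IsMerge k (List.replicate cs.flatten.length 0) cs.flatten
      (blocksWord (cs.map fun c => (k + 1, c.length - 1))) := by
  induction cs with
  | nil => exact ⟨fun _ _ _ => rfl, rfl, rfl⟩
  | cons c cs ih =>
    obtain ⟨hlen, hc⟩ := hcs c (by simp)
    rw [List.map_cons, blocksWord_cons, List.flatten_cons, List.length_append, List.replicate_add]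
    refine IsMerge.append ?_ (ih fun c' hc' => hcs c' (by simp [hc'])) (by simp)
    obtain ⟨m, hm⟩ : ∃ m, c.length = m + 1 := ⟨c.length - 1, by omega⟩
    rw [hm, Nat.add_sub_cancel] at hc
    rw [hm, Nat.add_sub_cancel, hc]
    refine ⟨fun j h1 h2 => ?_, ?_, ?_⟩
    · have : ¬ k + 1 = j := by omega
      have : ¬ 0 = j := by omega
      simp [List.replicate_succ, *]
    · simp
    · simp [join2, List.replicate_succ]

theorem BlockRefine.exists_blocks {n k a m : ℕ} {r : List Bool} (hr : BlockRefine n r)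
    (hlen : r.length = m + 1) (ha : 1 ≤ a) (hak : a ≤ k) :
    ∃ bs : List (ℕ × ℕ), bs.map Prod.fst = a :: List.replicate (n + 4) (k + 1) ∧
      (∀ b ∈ bs, 1 ≤ b.1 ∧ b.1 ≤ k + 1 ∧ n + 1 ≤ b.2) ∧
      IsMerge k (a :: List.replicate m 0) r (blocksWord bs) := by
  obtain ⟨z, cs, rfl, -, hz, hzf, hcs, hblk⟩ := hr
  obtain ⟨s, hs⟩ : ∃ s, z.length = s + 1 := ⟨z.length - 1, by omega⟩
  obtain rfl : z = List.replicate (s + 1) false := List.eq_replicate_iff.2 ⟨hs, hzf⟩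
  refine ⟨(a, s) :: cs.map fun c => (k + 1, c.length - 1), ?_, ?_, ?_⟩
  · simp [← hcs, Function.comp_def]
  · intro b hb
    rcases List.mem_cons.1 hb with rfl | hb
    · exact ⟨ha, by omega, by omega⟩
    · obtain ⟨c, hc, rfl⟩ := List.mem_map.1 hb
      have := (hblk c hc).1
      exact ⟨by omega, le_rfl, by dsimp only; omega⟩
  · have hm : m = s + cs.flatten.length := by
      rw [List.length_append, hs] at hlen; omega
    rw [hm, List.replicate_add, ← List.cons_append, blocksWord_cons]
    refine IsMerge.append ?_ (isMerge_replicate_zero cs hblk) (by simp)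
    refine ⟨fun _ _ _ => rfl, ?_, ?_⟩
    · have : ¬ a = k + 1 := by omega
      simp [List.replicate_succ, this]
    · simp [join2, List.replicate_succ]

theorem exists_blocks_of_refine {n k : ℕ} (bs : List (ℕ × ℕ)) (rs : List (List Bool))
    (hbs : ∀ b ∈ bs, 1 ≤ b.1 ∧ b.1 ≤ k) (hlen : bs.length = rs.length)
    (hrs : ∀ pr ∈ List.zip bs rs, pr.2.length = pr.1.2 + 1 ∧ BlockRefine n pr.2) :
    ∃ bs' : List (ℕ × ℕ), bs'.map Prod.fst = refineHeads n (k + 1) (bs.map Prod.fst) ∧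
      (∀ b ∈ bs', 1 ≤ b.1 ∧ b.1 ≤ k + 1 ∧ n + 1 ≤ b.2) ∧
      IsMerge k (blocksWord bs) rs.flatten (blocksWord bs') ∧
      rs.flatten.length = (blocksWord bs).length := by
  induction bs generalizing rs with
  | nil =>
    obtain rfl : rs = [] := List.length_eq_zero_iff.1 hlen.symm
    exact ⟨[], rfl, by simp, ⟨fun _ _ _ => rfl, rfl, rfl⟩, rfl⟩
  | cons b bs ih =>
    obtain _ | ⟨r, rs⟩ := rs
    · simp at hlen
    obtain ⟨hrlen, hr⟩ := hrs (b, r) (by simp)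
    obtain ⟨hb1, hbk⟩ := hbs b (by simp)
    obtain ⟨ds, hd1, hd2, hd3⟩ := hr.exists_blocks hrlen hb1 hbk
    obtain ⟨bs', h1, h2, h3, h4⟩ := ih rs (fun b' hb' => hbs b' (by simp [hb']))
      (by simpa using hlen) (fun pr hpr => hrs pr (by simp [hpr]))
    refine ⟨ds ++ bs', ?_, ?_, ?_, ?_⟩
    · rw [List.map_append, hd1, h1]; rfl
    · intro c hc
      rcases List.mem_append.1 hc with hc | hc
      · exact hd2 c hc
      · exact h2 c hc
    · rw [blocksWord_append, blocksWord_cons, List.flatten_cons]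
      exact hd3.append h3 (by simpa using hrlen)
    · simp only [List.flatten_cons, List.length_append, blocksWord_cons, h4, hrlen,
        List.length_cons, List.length_replicate]

/-- The blocks `bs` describe `w_1, …, w_k`: the letter at each position is the index of the word
carrying `p` there. -/
structure IsLevel (n : ℕ) (w : ℕ → List Bool) (k : ℕ) (bs : List (ℕ × ℕ)) : Prop where
  block : ∀ b ∈ bs, 1 ≤ b.1 ∧ b.1 ≤ k ∧ n + 1 ≤ b.2
  heads : refineHeadsIter n k (n - k) (bs.map Prod.fst) =
    refineHeadsIter n 1 (n - 1) (List.replicate (n + 4) 1)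
  word : ∀ j, 1 ≤ j → j ≤ k → w j = (blocksWord bs ++ [1]).map (· == j)
  join : joinUpTo w k = (blocksWord bs ++ [1]).map (· != 0)

theorem isLevel_one {n ℓ : ℕ} {w : ℕ → List Bool} (hw : FractalReq n ℓ w) :
    ∃ bs, IsLevel n w 1 bs := by
  obtain ⟨-, -, ⟨bls, hbls, hw1, hlen⟩, -⟩ := hw
  have key : ∀ f : ℕ → Bool, f 0 = false → f 1 = true →
      (blocksWord (bls.map fun b : List Bool => (1, b.length - 1)) ++ [1]).map f = bls.flatten ++ [true] := by
    intro f h0 h1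
    clear hw1 hlen
    induction bls with
    | nil => simp [blocksWord, h1]
    | cons b bls ih =>
      have hb := (hbls b (by simp)).2
      have := ih fun b' hb' => hbls b' (by simp [hb'])
      rw [List.map_cons, blocksWord_cons, List.append_assoc, List.map_append, this,
        List.flatten_cons, List.append_assoc]
      congr 1
      conv_rhs => rw [hb]
      simp [h0, h1]
  refine ⟨bls.map fun b => (1, b.length - 1), ?_, ?_, ?_, ?_⟩
  · intro b hb
    obtain ⟨c, hc, rfl⟩ := List.mem_map.1 hb
    have := (hbls c hc).1
    exact ⟨le_rfl, le_rfl, by dsimp only; omega⟩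
  · simp [← hlen, Function.comp_def]
  · intro j h1 h2
    obtain rfl : j = 1 := by omega
    rw [key _ rfl rfl]
    exact hw1
  · rw [key _ rfl rfl]; exact hw1

theorem joinUpTo_succ (w : ℕ → List Bool) {k : ℕ} (hk : 1 ≤ k) :
    joinUpTo w (k + 1) = join2 (joinUpTo w k) (w (k + 1)) := by
  obtain ⟨k, rfl⟩ : ∃ k', k = k' + 1 := ⟨k - 1, by omega⟩
  rfl

theorem IsLevel.succ {n k : ℕ} {w : ℕ → List Bool} {bs : List (ℕ × ℕ)} (h : IsLevel n w k bs)
    (hk1 : 1 ≤ k) (hkn : k < n) (hw : SuccRel n (joinUpTo w k) (w (k + 1))) :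
    ∃ bs', IsLevel n w (k + 1) bs' := by
  obtain ⟨bls, rs, hbls, hj, hwk, hlen, hrs⟩ := hw
  have hmap : (bs.map fun b => true :: List.replicate b.2 false) = bls := by
    refine blocks_unique ?_ (fun b hb => (hbls b hb).2) ?_
    · intro b hb
      obtain ⟨c, -, rfl⟩ := List.mem_map.1 hb
      simp
    · rw [← hj, h.join, List.map_append]
      congr 1
      have := h.block
      clear * - this
      induction bs with
      | nil => rfl
      | cons b bs ih =>
        have hb : b.1 ≠ 0 := by have := (this b (by simp)).1; omega
        rw [blocksWord_cons, List.map_append, ← ih fun b' hb' => this b' (by simp [hb'])]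
        simp [hb]
  subst hmap
  obtain ⟨bs', h1, h2, h3, h4⟩ := exists_blocks_of_refine (n := n) (k := k) bs rs
    (fun b hb => ⟨(h.block b hb).1, (h.block b hb).2.1⟩) (by simpa using hlen) (by
      intro pr hpr
      have := hrs (true :: List.replicate pr.1.2 false, pr.2) (by
        rw [List.zip_map_left]
        exact List.mem_map.2 ⟨pr, hpr, rfl⟩)
      simpa using this)
  have hmerge : IsMerge k (blocksWord bs ++ [1]) (rs.flatten ++ [false]) (blocksWord bs' ++ [1]) :=
    h3.append ⟨fun _ _ _ => rfl, by simp; omega, rfl⟩ h4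
  refine ⟨bs', h2, ?_, ?_, ?_⟩
  · rw [h1, ← h.heads, show n - k = n - (k + 1) + 1 by omega]
    rfl
  · intro j hj1 hj2
    rcases Nat.lt_or_ge k j with hjk | hjk
    · obtain rfl : j = k + 1 := by omega
      rw [hwk, hmerge.new]
    · rw [h.word j hj1 hjk, hmerge.old j hj1 hjk]
  · rw [joinUpTo_succ w hk1, h.join, hwk, hmerge.join]

theorem FractalReq.exists_isLevel {n ℓ : ℕ} {w : ℕ → List Bool} (hw : FractalReq n ℓ w)
    (k : ℕ) (hk1 : 1 ≤ k) (hkn : k ≤ n) : ∃ bs, IsLevel n w k bs := by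
  induction k, hk1 using Nat.le_induction with
  | base => exact isLevel_one hw
  | succ k hk ih =>
    obtain ⟨bs, hbs⟩ := ih (by omega)
    exact hbs.succ hk (by omega) (hw.2.2.2 k hk (by omega))

theorem eq_of_count_take_eq {l : List ℕ} {a i j : ℕ} (hi : l[i]? = some a) (hj : l[j]? = some a)
    (h : (l.take i).count a = (l.take j).count a) : i = j := by
  have key : ∀ i j, l[i]? = some a → i < j → (l.take i).count a < (l.take j).count a := by
    intro i j hi hij
    have h1 : (l.take (i + 1)).count a = (l.take i).count a + 1 := by
      rw [List.take_add_one, hi]; simp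
    have h2 : (l.take (i + 1)).Sublist (l.take j) := (List.take_prefix_take_left hij).sublist
    have := h2.count_le a
    omega
  rcases lt_trichotomy i j with hij | hij | hij
  · have := key i j hi hij; omega
  · exact hij
  · have := key j i hj hij; omega

theorem card_filter_range_eq_count_take (l : List ℕ) (a i : ℕ) :
    ((Finset.range i).filter fun t => l[t]? = some a).card = (l.take i).count a := by
  induction i with
  | zero => simp
  | succ i ih =>
    rw [Finset.range_add_one, Finset.filter_insert, List.take_add_one, List.count_append, ← ih]
    split_ifs with h
    · rw [Finset.card_insert_of_notMem (by simp), h]; simp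
    · cases h' : l[i]? with
      | none => simp
      | some b =>
        have : b ≠ a := fun hb => h (by rw [h', hb])
        simp [this]

theorem IsAlert.count_take {ℓ ia : ℕ} {l : List ℕ} (h : IsAlert ℓ (l.map (· == 1)) ia) :
    l[ia - 1]? = some 1 ∧ (l.take (ia - 1)).count 1 = 2 := by
  obtain ⟨h1, h2, h3, h4⟩ := h
  have hget : ∀ t, (l.map (· == 1)).getD t false = true ↔ l[t]? = some 1 := by
    intro t
    rw [List.getD_eq_getElem?_getD, List.getElem?_map]
    cases l[t]? <;> simp
  refine ⟨(hget _).1 h3, ?_⟩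
  rw [← h4, ← card_filter_range_eq_count_take]
  refine Finset.card_bij (fun t _ => t + 1) ?_ (fun _ _ _ _ h => Nat.succ_injective h) ?_
  · intro t ht
    simp only [Finset.mem_filter, Finset.mem_range] at ht
    simp only [Finset.mem_filter, Finset.mem_Icc]
    exact ⟨by omega, by omega, (hget t).2 ht.2⟩
  · intro t ht
    simp only [Finset.mem_filter, Finset.mem_Icc] at ht
    refine ⟨t - 1, ?_, by omega⟩
    simp only [Finset.mem_filter, Finset.mem_range]
    exact ⟨by omega, (hget _).1 ht.2.2⟩

/-- Replacing the letter at the alert position by the hidden letter `h` is undetectable. -/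
theorem IsLevel.alert_equiv {n ℓ ia h : ℕ} {w : ℕ → List Bool} {bs : List (ℕ × ℕ)}
    (hbs : IsLevel n w n bs) (hn : 1 < n) (hia : IsAlert ℓ (w 1) ia) (hh : h ≤ n) :
    WordEquiv n (blocksWord bs ++ [1]) ((blocksWord bs ++ [1]).set (ia - 1) h) := by
  rw [hbs.word 1 le_rfl hn.le] at hia
  obtain ⟨hget, hcount⟩ := hia.count_take
  by_cases h1 : h = 1
  · subst h1
    convert WordEquiv.refl n _ using 1
    refine List.ext_getElem? fun t => ?_
    rw [List.getElem?_set]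
    split_ifs with ht hlt
    · rw [← ht, hget]
    · rw [← ht, List.getElem?_eq_none (by omega)]
    · rfl
  have hheads := hbs.heads
  rw [Nat.sub_self] at hheads
  have hheads' : bs.map Prod.fst = refineHeadsIter n 1 (n - 1) (List.replicate (n + 4) 1) := hheads
  obtain ⟨t, ht, hta⟩ := exists_refineHeadsIter_singleton n 1 (n - 1)
  set tail := t ++ refineHeadsIter n 1 (n - 1) (List.replicate (n + 1) 1) with htail
  have hsplit : ∀ a, refineHeadsIter n 1 (n - 1) ([1, 1] ++ a :: List.replicate (n + 1) 1) =
      (1 :: t ++ 1 :: t) ++ a :: tail := by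
    intro a
    rw [show [1, 1] ++ a :: List.replicate (n + 1) 1 =
      [1] ++ ([1] ++ ([a] ++ List.replicate (n + 1) 1)) from rfl, refineHeadsIter_append,
      refineHeadsIter_append, refineHeadsIter_append, hta, hta]
    simp [htail]
  have hrep : List.replicate (n + 4) 1 = [1, 1] ++ 1 :: List.replicate (n + 1) 1 := rfl
  have hmap := hheads'
  rw [hrep, hsplit] at hmap
  obtain ⟨bs1, bs2, rfl, hm1, hm2⟩ := List.map_eq_append_iff.1 hmap
  obtain ⟨⟨b, m⟩, bs2, rfl, hb, hm3⟩ := List.map_eq_cons_iff.1 hm2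
  obtain rfl : b = 1 := hb
  have ht1 : t.count 1 = 0 := List.count_eq_zero.2 fun hmem => absurd (ht 1 hmem) (lt_irrefl 1)
  have hword : ∀ a, blocksWord (bs1 ++ (a, m) :: bs2) ++ [1] =
      blocksWord bs1 ++ a :: (List.replicate m 0 ++ blocksWord bs2 ++ [1]) := by
    intro a; simp [blocksWord_append, blocksWord_cons]
  have hpos : ia - 1 = (blocksWord bs1).length := by
    refine eq_of_count_take_eq hget ?_ ?_
    · rw [hword]; simp
    · rw [hcount, hword, List.take_left, count_blocksWord one_ne_zero, hm1]
      simp [ht1]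
  have hset : (blocksWord (bs1 ++ (1, m) :: bs2) ++ [1]).set (ia - 1) h =
      blocksWord (bs1 ++ (h, m) :: bs2) ++ [1] := by
    rw [hword, hword, hpos]
    simp
  rw [hset]
  refine WordEquiv.append ?_ (WordEquiv.refl n _)
  have hlong : ∀ a, ∀ b ∈ bs1 ++ (a, m) :: bs2, n + 1 ≤ b.2 := by
    have := fun b hb => (hbs.block b hb).2.2
    intro a b hb
    simp only [List.mem_append, List.mem_cons] at hb this
    rcases hb with hb | rfl | hb
    · exact this b (Or.inl hb)
    · exact this (1, m) (Or.inr (Or.inl rfl))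
    · exact this b (Or.inr (Or.inr hb))
  refine (blocksWord_equiv _ (hlong 1)).trans (WordEquiv.trans ?_
    (blocksWord_equiv _ (hlong h)).symm)
  have hmap' : (bs1 ++ (h, m) :: bs2).map Prod.fst =
      refineHeadsIter n 1 (n - 1) ([1, 1] ++ h :: List.replicate (n + 1) 1) := by
    rw [hsplit, List.map_append, List.map_cons, hm1, hm3]
  rw [hheads', hmap']
  exact levelWord_alert_equiv hn (by omega)

namespace KLTLKnData

variable {n ℓ : ℕ} {T : TreeKripke Unit} (D : KLTLKnData n T ℓ)

theorem w_eq_map {bs : List (ℕ × ℕ)} (hbs : IsLevel n D.w n bs) {j : ℕ} (hj : j ≤ n) :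
    D.w j = (blocksWord bs ++ [1]).map (· == j) := by
  rcases Nat.eq_zero_or_pos j with rfl | h
  · rw [D.w0_dual, hbs.join, List.map_map]
    refine List.map_congr_left fun a _ => ?_
    simp [bne]
  · exact hbs.word j h hj

theorem mem_V_path_iff {bs : List (ℕ × ℕ)} (hbs : IsLevel n D.w n bs) {j : ℕ} (hj : j ≤ n)
    (i : ℕ) : () ∈ T.V (D.path j (i + 1)) ↔ appendWord (blocksWord bs ++ [1]) (fun _ => 0) i = j := by
  have hlen : (blocksWord bs ++ [1]).length = ℓ := by
    rw [← D.w0_len, D.w_eq_map hbs (Nat.zero_le n), List.length_map]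
  rcases Nat.lt_or_ge i ℓ with hi | hi
  · have h : () ∈ T.V (D.path j (i + 1)) ↔ (D.w j).getD (i + 1 - 1) false = true := by
      rcases Nat.eq_zero_or_pos j with rfl | h
      · exact D.trace_eta₁ (i + 1) (by omega) (by omega)
      · rw [D.path_of_pos h]
        exact D.trace_xi₁ j h hj (i + 1) (by omega) (by omega)
    rw [h, D.w_eq_map hbs hj, appendWord_of_lt _ _ (by omega) 0, Nat.add_sub_cancel,
      List.getD_eq_getElem _ _ (by rw [List.length_map]; omega),
      List.getD_eq_getElem _ _ (by omega), List.getElem_map, beq_iff_eq]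
  · obtain ⟨q, rfl⟩ : ∃ q, i = q + (blocksWord bs ++ [1]).length := ⟨i - ℓ, by omega⟩
    rw [appendWord_add_length]
    rcases Nat.eq_zero_or_pos j with rfl | h
    · exact iff_of_true (D.trace_eta₂ _ (by omega)) rfl
    · rw [D.path_of_pos h]
      exact iff_of_false (D.trace_xi₂ j h hj _ (by omega)) (by omega)

end KLTLKnData

theorem appendWord_set {l : List ℕ} {s : ℕ → ℕ} {i a : ℕ} (hi : i < l.length) (t : ℕ) :
    appendWord (l.set i a) s t = if t = i then a else appendWord l s t := by
  induction l generalizing i t with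
  | nil => simp at hi
  | cons b l ih =>
    cases i with
    | zero => cases t <;> rfl
    | succ i =>
      cases t with
      | zero => rfl
      | succ t => simpa [appendWord] using ih (by simpa using hi) t

/-- **Small HyperCTL\* sentences cannot distinguish `K_n` from `M_n`** (KLTL
section): for every `n > 1` and every HyperCTL* sentence `ψ` with `|ψ| < n`,
`K_n ⊨ ψ` iff `M_n ⊨ ψ`. -/
theorem Kn_Mn_indistinguishable_by_HyperCTLstar :
    ∀ n : ℕ, 1 < n → ∀ T : TreeKripke Unit, IsRegularTree T →
      ∀ ℓ : ℕ, 1 < ℓ → ∀ D : KLTLKnData n T ℓ,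
        ∀ ia : ℕ, IsAlert ℓ (D.w 1) ia →
          ∀ M : TreeKripke Unit, MObtainedKLTL M D ia →
            ∀ (Var : Type) [DecidableEq Var] (ψ : HCTLs Unit Var),
              HCTLs.isSentence ψ → HCTLs.size ψ < n →
              (HCTLs.modelsT T ψ ↔ HCTLs.modelsT M ψ) := by
  intro n hn T _ ℓ _ D ia hia M hM Var _ ψ hψ hsize
  obtain ⟨-, hedge, hV⟩ := hM
  obtain ⟨bs, hbs⟩ := D.fractal.exists_isLevel n hn.le le_rfl
  have hTM : ∀ pa, M.TInit pa ↔ T.TInit pa := fun pa => by simp only [TreeKripke.TInit, hedge]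
  have hTroot : () ∉ T.V [] := D.pEta_init.1 ▸ D.trace_eta₀
  have hpath1 : D.pXi 1 = D.path 1 := (D.path_of_pos le_rfl).symm
  have hMroot : () ∉ M.V [] := by
    rw [hV, if_neg]
    · exact hTroot
    · intro h
      have := (D.pXi_init 1 le_rfl hn.le).length_eq ia
      rw [← h, List.length_nil] at this
      have := hia.1
      omega
  have hia1 := hia.1
  have hlen : (blocksWord bs ++ [1]).length = ℓ := by
    rw [← D.w0_len, D.w_eq_map hbs (Nat.zero_le n), List.length_map]
  have hialt : ia - 1 < (blocksWord bs ++ [1]).length := by rw [hlen]; have := hia.2.1; omega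
  have hletter : appendWord (blocksWord bs ++ [1]) (fun _ => 0) (ia - 1) = 1 := by
    have h := hia
    rw [D.w_eq_map hbs hn.le] at h
    rw [appendWord_of_lt _ _ hialt 0, List.getD_eq_getElem?_getD, h.count_take.1]
    rfl
  have hread : ∀ h ≤ n, ∃ L L', ReadsWord T D.path n h L ∧ ReadsWord M D.path n h L' ∧
      ∀ (φ : HCTLs Unit Var) (σ : Var → ℕ) (y : Var), φ.size < n →
        (φ.satWord L σ y 0 ↔ φ.satWord L' σ y 0) := by
    intro h hh
    refine ⟨appendWord (blocksWord bs ++ [1]) fun _ => 0,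
      appendWord ((blocksWord bs ++ [1]).set (ia - 1) h) fun _ => 0, ⟨?_, ?_, ?_⟩, ⟨?_, ?_, ?_⟩, ?_⟩
    · exact fun j hj => D.path_init hj
    · exact fun pa hpa j hj i hi heq => D.path_eq_of_agree hpa hj hi heq
    · exact fun j hj _ i => D.mem_V_path_iff hbs hj i
    · exact fun j hj => (hTM _).2 (D.path_init hj)
    · exact fun pa hpa j hj i hi heq => D.path_eq_of_agree ((hTM _).1 hpa) hj hi heq
    · intro j hj hjh i
      rw [hV, hpath1, appendWord_set hialt]
      by_cases hi : i = ia - 1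
      · subst hi
        rw [if_pos rfl, Nat.sub_add_cancel hia1]
        by_cases hj1 : j = 1
        · subst hj1
          simpa using hjh.symm
        · rw [if_neg fun heq => hj1 (D.path_injective hj hn.le hia1 heq)]
          have := D.mem_V_path_iff hbs hj (ia - 1)
          rw [Nat.sub_add_cancel hia1, hletter] at this
          rw [this]
          exact iff_of_false (fun h => hj1 h.symm) (fun h => hjh h.symm)
      · rw [if_neg hi, if_neg]
        · exact D.mem_V_path_iff hbs hj i
        · intro heq
          have := congrArg List.length heq
          rw [(D.path_init hj).length_eq, (D.path_init hn.le).length_eq] at this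
          omega
    · intro φ σ y hφ
      exact hbs.alert_equiv hn hia hh [] (fun _ => 0) Var φ σ y hφ
  have hsat : ∀ A y, ψ.satT T A y 0 ↔ ψ.satT M A y 0 := fun A y =>
    satT_zero_iff_of_isSentence hTM (fun pa hpa => D.exists_eq_path hpa)
      (satT_zero_iff_of_readsWord hTM hTroot hMroot (fun pa hpa => D.exists_eq_path hpa) hread)
      ψ A y hψ hsize
  simp only [HCTLs.modelsT, hTM, hsat]
end

section
/- For every n>1, every h*∈[1,n], every HyperCTL* formula ψ with |ψ|≤n, and all main positions ℓ,ℓ' with (ℓ,ℓ')∈R(h*,|ψ|): (1) if h*=1, then for every path assignment Π and every variable x, Π,x,ℓ ⊨_{K_n} ψ iff Π,x,ℓ' ⊨_{K_n} ψ; and (2) if h*∈[2,n], then for every path assignment Π whose image does not contain the initial path π(ξ_{h*}), and every variable x, Π,x,ℓ ⊨_{M_n} ψ iff Π,x,ℓ' ⊨_{M_n} ψ. -/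
/-- `p ∈ w_k(i-1)`: the label of `π(ξ_k)` at main position `i` in `K_n`. -/
def LabW (w : ℕ → List Bool) (k i : ℕ) : Prop := (w k).getD (i - 1) false = true

/-- A main position: a position in `[1, ℓ]`. -/
def MainPos (ℓ i : ℕ) : Prop := 1 ≤ i ∧ i ≤ ℓ

/-- `i` is a main `p`-position of type `ξ_k` (in `K_n`). -/
def HasType (n ℓ : ℕ) (w : ℕ → List Bool) (i k : ℕ) : Prop :=
  MainPos ℓ i ∧ 1 ≤ k ∧ k ≤ n ∧ LabW w k i

/-- A main `p`-position. -/
def PPos (n ℓ : ℕ) (w : ℕ → List Bool) (i : ℕ) : Prop :=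
  ∃ k, HasType n ℓ w i k

/-- A main `∅`-position. -/
def ZPos (n ℓ : ℕ) (w : ℕ → List Bool) (i : ℕ) : Prop :=
  MainPos ℓ i ∧ ¬ PPos n ℓ w i

/-- `j = p(i)`: the least main `p`-position `≥ i`. -/
def PAfter (n ℓ : ℕ) (w : ℕ → List Bool) (i j : ℕ) : Prop :=
  PPos n ℓ w j ∧ i ≤ j ∧ ∀ j', PPos n ℓ w j' → i ≤ j' → j ≤ j'

/-- The `h*`-type of a main `p`-position: its type, except that for `h* ≠ 1` the
`h*`-type of `i_alert` is `ξ_{h*}`. -/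
def HType (n ℓ : ℕ) (w : ℕ → List Bool) (ia h i k : ℕ) : Prop :=
  (h ≠ 1 ∧ i = ia ∧ PPos n ℓ w i ∧ k = h) ∨
  (¬(h ≠ 1 ∧ i = ia) ∧ HasType n ℓ w i k)

/-- `[i, j]` is an `h*`-macro-block: `i < j` are main `p`-positions of the same
`h*`-type `ξ_k` and no main `p`-position strictly between them has `h*`-type
`⪯ ξ_k`. -/
def MacroBlock (n ℓ : ℕ) (w : ℕ → List Bool) (ia h i j : ℕ) : Prop :=
  i < j ∧ ∃ k, HType n ℓ w ia h i k ∧ HType n ℓ w ia h j k ∧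
    ∀ m r, i < m → m < j → HType n ℓ w ia h m r → k < r

/-- The `h*`-macro-block `[i, j]` has `h*`-order `m`: the maximal chain of
consecutive `h*`-successors starting at `[i, j]` has length `m`. -/
def BlockOrder (n ℓ : ℕ) (w : ℕ → List Bool) (ia h i j m : ℕ) : Prop :=
  1 ≤ m ∧ ∃ c : ℕ → ℕ, c 0 = i ∧ c 1 = j ∧
    (∀ t, t < m → MacroBlock n ℓ w ia h (c t) (c (t + 1))) ∧
    ¬ ∃ j', MacroBlock n ℓ w ia h (c m) j'

/-- The `h*`-order of a main `p`-position `i`: the `h*`-order of the `h*`-macro-block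
with first position `i`, or `0` if there is none. -/
def POrder (n ℓ : ℕ) (w : ℕ → List Bool) (ia h i m : ℕ) : Prop :=
  (m = 0 ∧ ¬ ∃ j, MacroBlock n ℓ w ia h i j) ∨
  ∃ j, BlockOrder n ℓ w ia h i j m

/-- `j` is the `h*`-low-ancestor of `i`: the least main `p`-position `> i` whose
`h*`-type is strictly below that of `i`. -/
def LowAnc (n ℓ : ℕ) (w : ℕ → List Bool) (ia h i j : ℕ) : Prop :=
  ∃ k, HType n ℓ w ia h i k ∧ i < j ∧ (∃ r, HType n ℓ w ia h j r ∧ r < k) ∧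
    ∀ j' r', i < j' → HType n ℓ w ia h j' r' → r' < k → j ≤ j'

/-- The `h*`-orders of `i` and `j` are equal or both exceed `m`. -/
def OrdCond (n ℓ : ℕ) (w : ℕ → List Bool) (ia h m i j : ℕ) : Prop :=
  ∃ oi oj, POrder n ℓ w ia h i oi ∧ POrder n ℓ w ia h j oj ∧
    (oi = oj ∨ (m < oi ∧ m < oj))

/-- `(h*, m)`-compatibility of main `p`-positions: same `h*`-type, orders equal or
both `> m`, and either the common `h*`-type is `ξ_1` or the `h*`-low-ancestors are
`(h*, m)`-compatible. -/
inductive PComp (n ℓ : ℕ) (w : ℕ → List Bool) (ia h m : ℕ) : ℕ → ℕ → Prop where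
  | base (i j : ℕ) : HType n ℓ w ia h i 1 → HType n ℓ w ia h j 1 →
      OrdCond n ℓ w ia h m i j → PComp n ℓ w ia h m i j
  | step (i j k ai aj : ℕ) : HType n ℓ w ia h i k → HType n ℓ w ia h j k →
      OrdCond n ℓ w ia h m i j →
      LowAnc n ℓ w ia h i ai → LowAnc n ℓ w ia h j aj →
      PComp n ℓ w ia h m ai aj → PComp n ℓ w ia h m i j

/-- The relation `R(h*, m)` on main positions. -/
def RPos (n ℓ : ℕ) (w : ℕ → List Bool) (ia h m i j : ℕ) : Prop :=
  (PPos n ℓ w i ∧ PPos n ℓ w j ∧ PComp n ℓ w ia h m i j) ∨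
  (ZPos n ℓ w i ∧ ZPos n ℓ w j ∧
    ∃ pi pj, PAfter n ℓ w i pi ∧ PAfter n ℓ w j pj ∧ PComp n ℓ w ia h m pi pj ∧
      (pi - i = pj - j ∨ (m < pi - i ∧ m < pj - j)))

/-- Every class met on `[x, e)` is met on `[y, e')` without meeting there beforehand
classes not already met on `[x, e)`. -/
def FirstVisitSim {α : Type*} (c : ℕ → α) (x e y e' : ℕ) : Prop :=
  ∀ i, x ≤ i → i < e → ∃ j, y ≤ j ∧ j < e' ∧ c i = c j ∧
    ∀ k', y ≤ k' → k' < j → ∃ k, x ≤ k ∧ k < i ∧ c k = c k'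

/-- The intervals `[x, e)` and `[y, e')` meet the same classes, in the same order of first
visits. -/
def FirstVisitEq {α : Type*} (c : ℕ → α) (x e y e' : ℕ) : Prop :=
  FirstVisitSim c x e y e' ∧ FirstVisitSim c y e' x e

theorem FirstVisitEq.symm {α : Type*} {c : ℕ → α} {x e y e' : ℕ}
    (H : FirstVisitEq c x e y e') : FirstVisitEq c y e' x e := ⟨H.2, H.1⟩

theorem FirstVisitSim.cons {α : Type*} {c : ℕ → α} {x e y e' : ℕ} (hc : c x = c y)
    (hy : y < e') (H : FirstVisitSim c (x + 1) e (y + 1) e') : FirstVisitSim c x e y e' := by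
  intro i hxi hie
  rcases hxi.eq_or_lt with rfl | hlt
  · exact ⟨y, le_rfl, hy, hc, fun k' h1 h2 => by omega⟩
  · obtain ⟨j, h1, h2, h3, h4⟩ := H i hlt hie
    refine ⟨j, by omega, h2, h3, fun k' hk1 hk2 => ?_⟩
    rcases hk1.eq_or_lt with rfl | hk
    · exact ⟨x, le_rfl, hlt, hc⟩
    · obtain ⟨k, g1, g2, g3⟩ := h4 k' hk hk2
      exact ⟨k, by omega, g2, g3⟩

theorem FirstVisitEq.cons {α : Type*} {c : ℕ → α} {x e y e' : ℕ} (hc : c x = c y)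
    (hx : x < e) (hy : y < e') (H : FirstVisitEq c (x + 1) e (y + 1) e') :
    FirstVisitEq c x e y e' :=
  ⟨H.1.cons hc hy, H.2.cons hc.symm hx⟩

theorem FirstVisitEq.of_loop {α : Type*} {c : ℕ → α} {x x₁ x₂ e y e' : ℕ}
    (hx : x ≤ x₁) (hx₂ : x₂ ≤ e) (hl : FirstVisitEq c x x₁ x₁ x₂)
    (H : FirstVisitEq c x₁ e y e') : FirstVisitEq c x e y e' := by
  constructor
  · intro i hxi hie
    rcases lt_or_ge i x₁ with hi | hi
    · obtain ⟨i', a1, a2, a3, a4⟩ := hl.1 i hxi hi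
      obtain ⟨j, b1, b2, b3, b4⟩ := H.1 i' a1 (by omega)
      refine ⟨j, b1, b2, a3.trans b3, fun k' h1 h2 => ?_⟩
      obtain ⟨k, c1, c2, c3⟩ := b4 k' h1 h2
      obtain ⟨l, d1, d2, d3⟩ := a4 k c1 c2
      exact ⟨l, d1, d2, d3.trans c3⟩
    · obtain ⟨j, b1, b2, b3, b4⟩ := H.1 i hi hie
      refine ⟨j, b1, b2, b3, fun k' h1 h2 => ?_⟩
      obtain ⟨k, c1, c2, c3⟩ := b4 k' h1 h2
      exact ⟨k, by omega, c2, c3⟩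
  · intro i hyi hie
    obtain ⟨j, b1, b2, b3, b4⟩ := H.2 i hyi hie
    rcases lt_or_ge j x₂ with hj | hj
    · obtain ⟨j', a1, a2, a3, a4⟩ := hl.2 j b1 hj
      refine ⟨j', a1, by omega, b3.trans a3, fun k' h1 h2 => ?_⟩
      obtain ⟨k, c1, c2, c3⟩ := a4 k' h1 h2
      obtain ⟨l, d1, d2, d3⟩ := b4 k c1 c2
      exact ⟨l, d1, d2, d3.trans c3⟩
    · refine ⟨j, by omega, b2, b3, fun k' h1 h2 => ?_⟩
      rcases lt_or_ge k' x₁ with hk | hk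
      · obtain ⟨k, c1, c2, c3, -⟩ := hl.1 k' h1 hk
        obtain ⟨l, d1, d2, d3⟩ := b4 k c1 (by omega)
        exact ⟨l, d1, d2, d3.trans c3.symm⟩
      · exact b4 k' hk h2

/-- The number of positions of rank `q` in `[x, ℓ]` that precede the first position of
rank less than `q`. -/
def rankCount (t : ℕ → ℕ) (ℓ q x : ℕ) : ℕ :=
  if x ≤ ℓ then
    if t x < q then 0
    else if t x = q then rankCount t ℓ q (x + 1) + 1 else rankCount t ℓ q (x + 1)
  else 0
termination_by ℓ + 1 - x

section RankCount

variable {t : ℕ → ℕ} {ℓ q x : ℕ}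

theorem rankCount_of_gt (h : ℓ < x) : rankCount t ℓ q x = 0 := by
  rw [rankCount, if_neg (by omega)]

theorem rankCount_of_rank_lt (h : t x < q) : rankCount t ℓ q x = 0 := by
  rw [rankCount]; simp [h]

theorem rankCount_self (h : x ≤ ℓ) (hq : t x = q) :
    rankCount t ℓ q x = rankCount t ℓ q (x + 1) + 1 := by
  rw [rankCount]; simp [h, hq]

theorem rankCount_of_lt_rank (hq : q < t x) :
    rankCount t ℓ q x = rankCount t ℓ q (x + 1) := by
  rw [rankCount]
  split_ifs <;> first | omega | rfl | (rw [rankCount_of_gt (by omega)])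

theorem rankCount_eq_of_forall_lt {y : ℕ} (hxy : x ≤ y)
    (H : ∀ z, x ≤ z → z < y → q < t z) : rankCount t ℓ q x = rankCount t ℓ q y := by
  induction y, hxy using Nat.le_induction with
  | base => rfl
  | succ y hy ih =>
    rw [ih fun z h1 h2 => H z h1 (by omega), rankCount_of_lt_rank (H y hy (by omega))]

theorem rankCount_pos (h : x ≤ ℓ) (hq : t x = q) : 0 < rankCount t ℓ q x := by
  rw [rankCount_self h hq]; omega

theorem exists_next_of_rankCount_pos (h : 0 < rankCount t ℓ q x) :
    ∃ y, x ≤ y ∧ y ≤ ℓ ∧ t y = q ∧ ∀ z, x ≤ z → z < y → q < t z := by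
  induction hd : ℓ + 1 - x generalizing x with
  | zero => rw [rankCount_of_gt (by omega)] at h; omega
  | succ d ih =>
    rcases lt_trichotomy (t x) q with hlt | heq | hgt
    · rw [rankCount_of_rank_lt hlt] at h; omega
    · exact ⟨x, le_rfl, by omega, heq, fun z h1 h2 => by omega⟩
    · rw [rankCount_of_lt_rank hgt] at h
      obtain ⟨y, h1, h2, h3, h4⟩ := ih h (by omega)
      refine ⟨y, by omega, h2, h3, fun z hz1 hz2 => ?_⟩
      rcases hz1.eq_or_lt with rfl | hz
      · exact hgt
      · exact h4 z hz hz2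

theorem card_le_rankCount {e : ℕ} (he : e ≤ ℓ + 1) (H : ∀ z, x ≤ z → z < e → q ≤ t z) :
    ((Finset.Ico x e).filter (fun z => t z = q)).card ≤ rankCount t ℓ q x := by
  induction hd : e - x generalizing x with
  | zero => simp [Finset.Ico_eq_empty_of_le (show e ≤ x by omega)]
  | succ d ih =>
    have ih' := ih (x := x + 1) (fun z h1 h2 => H z (by omega) h2) (by omega)
    rw [← Finset.insert_Ico_add_one_left_eq_Ico (by omega : x < e), Finset.filter_insert]
    split_ifs with htx
    · rw [rankCount_self (by omega) htx]
      exact (Finset.card_insert_le _ _).trans (by omega)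
    · have := H x le_rfl (by omega)
      rw [rankCount_of_lt_rank (by omega)]
      exact ih'

theorem rankCount_mono_of_raise {t' : ℕ → ℕ} (hq : 2 ≤ q)
    (H : ∀ x, t' x = t x ∨ t x = 1) : rankCount t ℓ q x ≤ rankCount t' ℓ q x := by
  induction hd : ℓ + 1 - x generalizing x with
  | zero => rw [rankCount_of_gt (by omega)]; omega
  | succ d ih =>
    have ih' := ih (x := x + 1) (by omega)
    rcases H x with hx | hx
    · rcases lt_trichotomy (t x) q with hlt | heq | hgt
      · rw [rankCount_of_rank_lt hlt]; omega
      · rw [rankCount_self (by omega) heq, rankCount_self (by omega) (hx.trans heq)]; omega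
      · rw [rankCount_of_lt_rank hgt, rankCount_of_lt_rank (t := t') (by omega)]; exact ih'
    · rw [rankCount_of_rank_lt (by omega)]; omega

end RankCount

/-- Ranks in `[1, n + 1]` on positions, with `ℓ` of rank `1`, such that after a position of
rank less than `q` there are at least `n + 1` positions of rank `q` before the next one of
rank less than `q`. -/
structure FractalRank (n ℓ : ℕ) (t : ℕ → ℕ) : Prop where
  one_le : ∀ x, 1 ≤ t x
  le : ∀ x, t x ≤ n + 1
  rank_last : t ℓ = 1
  rank_of_gt : ∀ x, ℓ < x → t x = n + 1
  large : ∀ x q, x < ℓ → t x < q → q ≤ n + 1 → n + 1 ≤ rankCount t ℓ q (x + 1)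

/-- The rank counts at `x`, truncated at `m + 1`. -/
def rankClass (t : ℕ → ℕ) (ℓ m x q : ℕ) : ℕ := min (rankCount t ℓ q x) (m + 1)

/-- `e` is the first position of rank at most `k` from `x` on, or `ℓ + 1` if there is none. -/
structure IsNextLow (t : ℕ → ℕ) (ℓ k x e : ℕ) : Prop where
  le : x ≤ e
  le_last : e ≤ ℓ + 1
  lt_rank : ∀ z, x ≤ z → z < e → k < t z
  rank_le : e ≤ ℓ → t e ≤ k

theorem IsNextLow.succ {t : ℕ → ℕ} {ℓ k x e : ℕ} (h : IsNextLow t ℓ k x e) (hx : x < e) :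
    IsNextLow t ℓ k (x + 1) e :=
  ⟨hx, h.le_last, fun z h1 h2 => h.lt_rank z (by omega) h2, h.rank_le⟩

/-- Truncated rank counts agree, with one more unit of precision above rank `k`. -/
def MixedEq (t : ℕ → ℕ) (ℓ m k x y : ℕ) : Prop :=
  (∀ q, k < q → min (rankCount t ℓ q x) (m + 2) = min (rankCount t ℓ q y) (m + 2)) ∧
  ∀ q, q ≤ k → min (rankCount t ℓ q x) (m + 1) = min (rankCount t ℓ q y) (m + 1)

theorem MixedEq.symm {t : ℕ → ℕ} {ℓ m k x y : ℕ} (h : MixedEq t ℓ m k x y) :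
    MixedEq t ℓ m k y x :=
  ⟨fun q hq => (h.1 q hq).symm, fun q hq => (h.2 q hq).symm⟩

theorem MixedEq.rankClass_eq {t : ℕ → ℕ} {ℓ m k x y : ℕ} (h : MixedEq t ℓ m k x y) :
    rankClass t ℓ m x = rankClass t ℓ m y := by
  funext q
  unfold rankClass
  rcases lt_or_ge k q with hq | hq
  · have := h.1 q hq; omega
  · exact h.2 q hq

theorem rankCount_pos_of_min_eq {t : ℕ → ℕ} {ℓ m q x y : ℕ}
    (h : min (rankCount t ℓ q x) (m + 1) = min (rankCount t ℓ q y) (m + 1))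
    (hx : x ≤ ℓ) (hq : t x = q) : y ≤ ℓ ∧ q ≤ t y := by
  have := rankCount_pos hx hq
  constructor
  · by_contra hc
    rw [rankCount_of_gt (x := y) (by omega)] at h
    omega
  · by_contra hc
    rw [rankCount_of_rank_lt (x := y) (by omega)] at h
    omega

theorem MixedEq.lt_end {t : ℕ → ℕ} {ℓ m k x y e e' : ℕ} (h : MixedEq t ℓ m k x y)
    (hx : IsNextLow t ℓ k x e) (hy : IsNextLow t ℓ k y e') (hxe : x < e) :
    y < e' ∧ t x ≤ t y := by
  have hk := hx.lt_rank x le_rfl hxe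
  obtain ⟨h1, h2⟩ := rankCount_pos_of_min_eq (h.1 _ hk) (by have := hx.le_last; omega) rfl
  refine ⟨?_, h2⟩
  rcases hy.le.eq_or_lt with rfl | h3
  · have := hy.rank_le h1
    omega
  · exact h3

theorem rankClass_of_gt {t : ℕ → ℕ} {ℓ m x : ℕ} (hx : ℓ < x) : rankClass t ℓ m x = fun _ => 0 := by
  funext q
  simp [rankClass, rankCount_of_gt hx]

theorem le_last_of_rankClass_eq {t : ℕ → ℕ} {ℓ m x y : ℕ}
    (h : rankClass t ℓ m x = rankClass t ℓ m y)
    (hx : x ≤ ℓ) : y ≤ ℓ ∧ t x ≤ t y :=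
  rankCount_pos_of_min_eq (congrFun h (t x)) hx rfl

theorem rankClass_mono {t : ℕ → ℕ} {ℓ m m' x y : ℕ} (hm : m' ≤ m)
    (h : rankClass t ℓ m x = rankClass t ℓ m y) : rankClass t ℓ m' x = rankClass t ℓ m' y := by
  funext q
  have := congrFun h q
  unfold rankClass at *
  omega

namespace FractalRank

variable {n ℓ : ℕ} {t : ℕ → ℕ} (F : FractalRank n ℓ t)
include F

theorem rankCount_one_pos {x : ℕ} (hx : x ≤ ℓ) : 0 < rankCount t ℓ 1 x := by
  induction hd : ℓ - x generalizing x with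
  | zero =>
    have : x = ℓ := by omega
    exact rankCount_pos hx (this ▸ F.rank_last)
  | succ d ih =>
    rcases (F.one_le x).eq_or_lt with h | h
    · exact rankCount_pos hx h.symm
    · rw [rankCount_of_lt_rank h]
      exact ih (by omega) (by omega)

theorem rankCount_of_gt_max {q x : ℕ} (hq : n + 1 < q) : rankCount t ℓ q x = 0 :=
  rankCount_of_rank_lt (by have := F.le x; omega)

theorem rankCount_zero (x : ℕ) : rankCount t ℓ 0 x = 0 := by
  by_contra h
  obtain ⟨y, -, -, hy, -⟩ := exists_next_of_rankCount_pos (Nat.pos_of_ne_zero h)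
  have := F.one_le y
  omega

theorem eq_last_of_rankCount {x : ℕ} (hx : x ≤ ℓ) (h : t x = 1) (h1 : rankCount t ℓ 1 x = 1) :
    x = ℓ := by
  rw [rankCount_self hx h] at h1
  by_contra hne
  have := F.rankCount_one_pos (x := x + 1) (by omega)
  omega

theorem rankCount_one_last : rankCount t ℓ 1 ℓ = 1 := by
  rw [rankCount_self le_rfl F.rank_last, rankCount_of_gt (by omega)]

theorem large_min_eq {x y q m : ℕ} (hm : m ≤ n + 1) (hx : x < ℓ) (hy : y < ℓ) (hqx : t x < q)
    (hqy : t y < q) : min (rankCount t ℓ q (x + 1)) m = min (rankCount t ℓ q (y + 1)) m := by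
  rcases lt_or_ge (n + 1) q with hq | hq
  · rw [F.rankCount_of_gt_max hq, F.rankCount_of_gt_max hq]
  · have := F.large x q hx hqx hq
    have := F.large y q hy hqy hq
    omega

theorem min_eq_succ {x y q m : ℕ} (hm : m ≤ n + 1) (hx : x ≤ ℓ) (hy : y ≤ ℓ) (ht : t x = t y)
    (hq : t x < q) (hl : x = ℓ ↔ y = ℓ) :
    min (rankCount t ℓ q (x + 1)) m = min (rankCount t ℓ q (y + 1)) m := by
  by_cases h : x = ℓ
  · have := hl.1 h
    rw [rankCount_of_gt (by omega), rankCount_of_gt (by omega)]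
  · exact F.large_min_eq hm (by omega) (by have := mt hl.2 h; omega) hq (by omega)

theorem eq_last_iff {x y m : ℕ} (hx : x ≤ ℓ) (hy : y ≤ ℓ) (ht : t x = t y)
    (h : min (rankCount t ℓ (t x) x) (m + 2) = min (rankCount t ℓ (t x) y) (m + 2)) :
    x = ℓ ↔ y = ℓ := by
  have hlast := F.rankCount_one_last
  constructor
  · rintro rfl
    rw [F.rank_last] at h ht
    exact F.eq_last_of_rankCount hy ht.symm (by omega)
  · rintro rfl
    rw [ht, F.rank_last] at h
    exact F.eq_last_of_rankCount hx (ht.trans F.rank_last) (by omega)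

theorem firstVisitEq_skip {m k x y e e' : ℕ} (hm : m + 1 ≤ n)
    (ihk : ∀ k' x e y e', k < k' → IsNextLow t ℓ k' x e → IsNextLow t ℓ k' y e' →
      MixedEq t ℓ m k' x y → FirstVisitEq (rankClass t ℓ m) x e y e')
    (hx : IsNextLow t ℓ k x e) (hR : MixedEq t ℓ m k x y)
    (ih : ∀ x₁, x < x₁ → x₁ ≤ e → IsNextLow t ℓ k x₁ e → MixedEq t ℓ m k x₁ y →
      FirstVisitEq (rankClass t ℓ m) x₁ e y e')
    (hxe : x < e) (ht : t x = t y)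
    (ho : rankCount t ℓ (t x) y < rankCount t ℓ (t x) x) :
    FirstVisitEq (rankClass t ℓ m) x e y e' := by
  obtain ⟨r, hr⟩ : ∃ r, t x = r := ⟨_, rfl⟩
  rw [hr] at ho
  have hkr : k < r := hr ▸ hx.lt_rank x le_rfl hxe
  have hle := hx.le_last
  have hoo := hR.1 r hkr
  have hs := rankCount_self (ℓ := ℓ) (by omega) hr
  obtain ⟨x₁, a1, a2, a3, a4⟩ := exists_next_of_rankCount_pos
    (show 0 < rankCount t ℓ r (x + 1) by omega)
  have hc1 := rankCount_eq_of_forall_lt (ℓ := ℓ) a1 a4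
  have hs1 := rankCount_self a2 a3
  obtain ⟨x₂, b1, b2, b3, b4⟩ := exists_next_of_rankCount_pos
    (show 0 < rankCount t ℓ r (x₁ + 1) by omega)
  have hc2 := rankCount_eq_of_forall_lt (ℓ := ℓ) b1 b4
  have before_end : ∀ u, x < u → u ≤ ℓ → t u = r → (∀ z, x ≤ z → z < u → r ≤ t z) → u < e := by
    intro u h1 h2 h3 h4
    by_contra hc
    have h5 := hx.rank_le (by omega)
    rcases (not_lt.1 hc).eq_or_lt with rfl | h6
    · omega
    · have := h4 e (by omega) h6
      omega
  have all1 : ∀ z, x ≤ z → z < x₁ → r ≤ t z := by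
    intro z h1 h2
    rcases h1.eq_or_lt with rfl | h3
    · exact hr.ge
    · exact (a4 z h3 h2).le
  have all2 : ∀ z, x ≤ z → z < x₂ → r ≤ t z := by
    intro z h1 h2
    rcases lt_trichotomy z x₁ with h3 | rfl | h3
    · exact all1 z h1 h3
    · exact a3.ge
    · exact (b4 z h3 h2).le
  have hx1e := before_end x₁ a1 a2 a3 all1
  have hx2e := before_end x₂ (by omega) b2 b3 all2
  have low1 : ∀ q, q < r → rankCount t ℓ q x = rankCount t ℓ q x₁ := fun q hq =>
    rankCount_eq_of_forall_lt (by omega) fun z h1 h2 => hq.trans_le (all1 z h1 h2)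
  have high : ∀ u q, t u = r → r < q → rankCount t ℓ q u = 0 := fun u q h1 h2 =>
    rankCount_of_rank_lt (by omega)
  have loop : FirstVisitEq (rankClass t ℓ m) (x + 1) x₁ (x₁ + 1) x₂ := by
    refine ihk r _ _ _ _ hkr ⟨a1, by omega, a4, fun _ => a3.le⟩
      ⟨b1, by omega, b4, fun _ => b3.le⟩ ⟨fun q hq => ?_, fun q hq => ?_⟩
    · exact F.large_min_eq (by omega) (by omega) (by omega) (by omega) (by omega)
    · rcases hq.eq_or_lt with rfl | hq
      · omega
      · rw [← rankCount_of_lt_rank (x := x) (by omega),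
          ← rankCount_of_lt_rank (x := x₁) (by omega), low1 q hq]
  have hcls : rankClass t ℓ m x = rankClass t ℓ m x₁ := by
    funext q
    unfold rankClass
    rcases lt_trichotomy q r with hq | rfl | hq
    · rw [low1 q hq]
    · omega
    · rw [high x q hr hq, high x₁ q a3 hq]
  refine FirstVisitEq.of_loop (x₁ := x₁) (x₂ := x₂) (by omega) hx2e.le
    (loop.cons hcls (by omega) (by omega)) (ih x₁ a1 hx1e.le
      ⟨hx1e.le, hle, fun z h1 h2 => hx.lt_rank z (by omega) h2, hx.rank_le⟩
      ⟨fun q hq => ?_, fun q hq => ?_⟩)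
  · rw [← hR.1 q hq]
    rcases lt_trichotomy q r with hq | rfl | hq
    · rw [low1 q hq]
    · omega
    · rw [high x q hr hq, high x₁ q a3 hq]
  · rw [← low1 q (by omega)]
    exact hR.2 q hq

theorem firstVisitEq {m : ℕ} (hm : m + 1 ≤ n) (k x e y e' : ℕ)
    (hx : IsNextLow t ℓ k x e) (hy : IsNextLow t ℓ k y e') (hR : MixedEq t ℓ m k x y) :
    FirstVisitEq (rankClass t ℓ m) x e y e' := by
  induction hd : n + 1 - k using Nat.strong_induction_on generalizing k x e y e' with
  | _ d ihk =>
  induction hs : (e - x) + (e' - y) using Nat.strong_induction_on generalizing x y with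
  | _ s ih =>
  rcases hx.le.eq_or_lt with rfl | hxe
  · have : y = e' := by
      by_contra hne
      have := (hR.symm.lt_end hy hx (by have := hy.le; omega)).1
      omega
    subst this
    exact ⟨fun i h1 h2 => by omega, fun i h1 h2 => by omega⟩
  obtain ⟨hye, hxy⟩ := hR.lt_end hx hy hxe
  have ht : t x = t y := le_antisymm hxy (hR.symm.lt_end hy hx hye).2
  have hk := hx.lt_rank x le_rfl hxe
  have hkn : k < n + 1 := hk.trans_le (F.le x)
  have hxl : x ≤ ℓ := by have := hx.le_last; omega
  have hyl : y ≤ ℓ := by have := hy.le_last; omega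
  have ihk' : ∀ k' x e y e', k < k' → IsNextLow t ℓ k' x e → IsNextLow t ℓ k' y e' →
      MixedEq t ℓ m k' x y → FirstVisitEq (rankClass t ℓ m) x e y e' :=
    fun k' x e y e' h1 h2 h3 h4 =>
      ihk (n + 1 - k') (by omega) k' x e y e' h2 h3 h4 rfl
  rcases lt_trichotomy (rankCount t ℓ (t x) x) (rankCount t ℓ (t x) y) with ho | ho | ho
  · exact (F.firstVisitEq_skip hm ihk' hy hR.symm
      (fun y₁ h1 h2 h3 h4 => (ih _ (by omega) x y₁ hx h3 h4.symm rfl).symm) hye ht.symm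
      (ht ▸ ho)).symm
  · have hl := F.eq_last_iff (m := 0) hxl hyl ht (by omega)
    refine FirstVisitEq.cons hR.rankClass_eq hxe hye
      (ih _ (by omega) (x + 1) (y + 1) (hx.succ hxe) (hy.succ hye) ⟨fun q hq => ?_,
        fun q hq => ?_⟩ rfl)
    · rcases lt_trichotomy q (t x) with hq' | rfl | hq'
      · rw [← rankCount_of_lt_rank hq', ← rankCount_of_lt_rank (ht ▸ hq')]
        exact hR.1 q hq
      · rw [rankCount_self hxl rfl, rankCount_self hyl ht.symm] at ho
        omega
      · exact F.min_eq_succ (by omega) hxl hyl ht hq' hl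
    · rw [← rankCount_of_lt_rank (by omega), ← rankCount_of_lt_rank (by omega)]
      exact hR.2 q hq
  · exact F.firstVisitEq_skip hm ihk' hx hR
      (fun x₁ h1 h2 h3 h4 => ih _ (by omega) x₁ y h3 hy h4 rfl) hxe ht ho

theorem rank_eq_of_rankClass_eq {m x y : ℕ} (h : rankClass t ℓ m x = rankClass t ℓ m y) :
    t x = t y := by
  rcases le_or_gt x ℓ with hx | hx
  · obtain ⟨h1, h2⟩ := le_last_of_rankClass_eq h hx
    exact le_antisymm h2 (le_last_of_rankClass_eq h.symm h1).2
  · have : ℓ < y := by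
      by_contra hc
      have := (le_last_of_rankClass_eq h.symm (by omega)).1
      omega
    rw [F.rank_of_gt x hx, F.rank_of_gt y this]

theorem rankClass_succ {m x y : ℕ} (hm : m + 1 ≤ n)
    (h : rankClass t ℓ (m + 1) x = rankClass t ℓ (m + 1) y) :
    rankClass t ℓ m (x + 1) = rankClass t ℓ m (y + 1) := by
  rcases le_or_gt x ℓ with hx | hx
  · have hy := (le_last_of_rankClass_eq h hx).1
    have ht := F.rank_eq_of_rankClass_eq h
    have hl := F.eq_last_iff hx hy ht (congrFun h (t x))
    funext q
    have hq := congrFun h q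
    unfold rankClass at *
    rcases lt_trichotomy q (t x) with hq' | rfl | hq'
    · rw [← rankCount_of_lt_rank hq', ← rankCount_of_lt_rank (ht ▸ hq')]
      omega
    · rw [rankCount_self hx rfl, rankCount_self hy ht.symm] at hq
      omega
    · exact F.min_eq_succ (by omega) hx hy ht hq' hl
  · have : ℓ < y := by
      by_contra hc
      have := (le_last_of_rankClass_eq h.symm (by omega)).1
      omega
    rw [rankClass_of_gt (by omega), rankClass_of_gt (by omega)]

theorem rankClass_until {m x y : ℕ} (hm : m + 1 ≤ n)
    (h : rankClass t ℓ (m + 1) x = rankClass t ℓ (m + 1) y) {i : ℕ} (hi : x ≤ i) :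
    ∃ j, y ≤ j ∧ rankClass t ℓ m i = rankClass t ℓ m j ∧
      ∀ k', y ≤ k' → k' < j → ∃ k, x ≤ k ∧ k < i ∧ rankClass t ℓ m k = rankClass t ℓ m k' := by
  rcases le_or_gt x ℓ with hx | hx
  · have hy := (le_last_of_rankClass_eq h hx).1
    have key := F.firstVisitEq hm 0 x (ℓ + 1) y (ℓ + 1)
      ⟨by omega, le_rfl, fun z _ _ => F.one_le z, fun h => by omega⟩
      ⟨by omega, le_rfl, fun z _ _ => F.one_le z, fun h => by omega⟩
      ⟨fun q _ => congrFun h q, fun q hq => by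
        rw [Nat.le_zero.1 hq, F.rankCount_zero, F.rankCount_zero]⟩
    rcases le_or_gt i ℓ with hil | hil
    · obtain ⟨j, h1, h2, h3, h4⟩ := key.1 i hi (by omega)
      exact ⟨j, h1, h3, h4⟩
    · refine ⟨ℓ + 1, by omega, ?_, fun k' h1 h2 => ?_⟩
      · rw [rankClass_of_gt (by omega), rankClass_of_gt (by omega)]
      · obtain ⟨k, g1, g2, g3, -⟩ := key.2 k' h1 h2
        exact ⟨k, g1, by omega, g3.symm⟩
  · have : ℓ < y := by
      by_contra hc
      have := (le_last_of_rankClass_eq h.symm (by omega)).1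
      omega
    refine ⟨y, le_rfl, ?_, fun k' h1 h2 => by omega⟩
    rw [rankClass_of_gt (by omega), rankClass_of_gt (by omega)]

/-- On a family `S` of paths that never branch after the root and whose labels depend only on
the rank of the position, positions with equal truncated rank counts satisfy the same
formulas. -/
theorem satT_iff {Var : Type} [DecidableEq Var] {T : TreeKripke Unit} {S : Set (ℕ → List ℕ)}
    (hbranch : ∀ pa ∈ S, ∀ pb, T.TInit pb → ∀ i, 1 ≤ i → (∀ j ≤ i, pb j = pa j) → pb = pa)
    (hinit : ∀ pa ∈ S, T.TInit pa)
    (hlab : ∀ pa ∈ S, ∃ L : Set ℕ, ∀ i, 1 ≤ i → (() ∈ T.V (pa i) ↔ t i ∈ L))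
    (ψ : HCTLs Unit Var) : ψ.size ≤ n → ∀ i j, 1 ≤ i → 1 ≤ j →
      rankClass t ℓ ψ.size i = rankClass t ℓ ψ.size j →
      ∀ A : Var → (ℕ → List ℕ), (∀ x, A x ∈ S) → ∀ x,
        (HCTLs.satT T ψ A x i ↔ HCTLs.satT T ψ A x j) := by
  induction ψ with
  | tt => intros; simp [HCTLs.satT]
  | atom p x =>
    intro hs i j hi hj hc A hA y
    obtain ⟨L, hL⟩ := hlab (A x) (hA x)
    simp only [HCTLs.satT]
    rw [hL i hi, hL j hj, F.rank_eq_of_rankClass_eq hc]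
  | neg φ ih =>
    intro hs i j hi hj hc A hA y
    simp only [HCTLs.size] at hs hc
    simp only [HCTLs.satT]
    rw [ih (by omega) i j hi hj (rankClass_mono (by omega) hc) A hA y]
  | conj φ ψ ih₁ ih₂ =>
    intro hs i j hi hj hc A hA y
    simp only [HCTLs.size] at hs hc
    simp only [HCTLs.satT]
    rw [ih₁ (by omega) i j hi hj (rankClass_mono (by omega) hc) A hA y,
      ih₂ (by omega) i j hi hj (rankClass_mono (by omega) hc) A hA y]
  | next φ ih =>
    intro hs i j hi hj hc A hA y
    simp only [HCTLs.size] at hs hc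
    simp only [HCTLs.satT]
    exact ih (by omega) _ _ (by omega) (by omega) (F.rankClass_succ hs hc) A hA y
  | untl φ ψ ih₁ ih₂ =>
    intro hs i j hi hj hc A hA y
    simp only [HCTLs.size] at hs hc
    simp only [HCTLs.satT]
    have transfer : ∀ i j, 1 ≤ i → 1 ≤ j →
        rankClass t ℓ (φ.size + ψ.size + 1) i = rankClass t ℓ (φ.size + ψ.size + 1) j →
        (∃ i', i ≤ i' ∧ HCTLs.satT T ψ A y i' ∧
          ∀ k, i ≤ k → k < i' → HCTLs.satT T φ A y k) →
        ∃ j', j ≤ j' ∧ HCTLs.satT T ψ A y j' ∧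
          ∀ k, j ≤ k → k < j' → HCTLs.satT T φ A y k := by
      rintro i j hi hj hc ⟨i', h1, h2, h3⟩
      obtain ⟨j', g1, g2, g3⟩ := F.rankClass_until hs hc h1
      refine ⟨j', g1, ?_, fun k' hk1 hk2 => ?_⟩
      · exact (ih₂ (by omega) i' j' (by omega) (by omega)
          (rankClass_mono (by omega) g2) A hA y).1 h2
      · obtain ⟨k, e1, e2, e3⟩ := g3 k' hk1 hk2
        exact (ih₁ (by omega) k k' (by omega) (by omega)
          (rankClass_mono (by omega) e3) A hA y).1 (h3 k e1 e2)
    exact ⟨transfer i j hi hj hc, transfer j i hj hi hc.symm⟩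
  | ex x φ ih =>
    intro hs i j hi hj hc A hA y
    simp only [HCTLs.size] at hs hc
    have hA' : ∀ z, Function.update A x (A y) z ∈ S := by
      intro z
      by_cases hz : z = x
      · subst hz; simpa using hA y
      · simpa [hz] using hA z
    have elim : ∀ i, 1 ≤ i → (HCTLs.satT T (.ex x φ) A y i ↔
        HCTLs.satT T φ (Function.update A x (A y)) x i) := by
      intro i hi
      simp only [HCTLs.satT]
      constructor
      · rintro ⟨pa, h1, h2, h3⟩
        rwa [hbranch (A y) (hA y) pa h1 i hi h2] at h3
      · intro h
        exact ⟨A y, hinit _ (hA y), fun _ _ => rfl, h⟩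
    rw [elim i hi, elim j hj]
    exact ih (by omega) i j hi hj (rankClass_mono (by omega) hc) _ hA' x

end FractalRank

theorem card_filter_range_getD (l : List Bool) :
    ((Finset.range l.length).filter (fun d => l.getD d false = true)).card = l.count true := by
  induction l using List.reverseRecOn with
  | nil => simp
  | append_singleton l a ih =>
    rw [List.length_append, List.length_singleton, Finset.range_add_one, Finset.filter_insert,
      List.count_append, ← ih]
    have : (Finset.range l.length).filter (fun d => (l ++ [a]).getD d false = true) =
        (Finset.range l.length).filter (fun d => l.getD d false = true) :=
      Finset.filter_congr fun d hd => by
        rw [List.getD_append _ _ _ _ (Finset.mem_range.1 hd)]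
    rw [this]
    cases a <;> simp

theorem length_le_count_flatten {n : ℕ} {cs : List (List Bool)} (h : ∀ c ∈ cs, IsNBlock n c) :
    cs.length ≤ cs.flatten.count true := by
  induction cs with
  | nil => simp
  | cons c cs ih =>
    have h1 := ih fun c hc => h c (by simp [hc])
    have h2 := (h c (by simp)).2
    rw [List.flatten_cons, List.count_append, h2, List.count_cons]
    simp
    omega

theorem BlockRefine.getD_zero {n : ℕ} {r : List Bool} (h : BlockRefine n r) :
    r.getD 0 false = false := by
  obtain ⟨z, cs, rfl, hz, -, hf, -, -⟩ := h
  obtain ⟨a, z, rfl⟩ := List.exists_cons_of_ne_nil hz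
  simpa using hf a (by simp)

theorem BlockRefine.le_count {n : ℕ} {r : List Bool} (h : BlockRefine n r) :
    n + 4 ≤ r.count true := by
  obtain ⟨z, cs, rfl, -, -, -, hl, hb⟩ := h
  have := length_le_count_flatten hb
  rw [List.count_append]
  omega

theorem IsNBlock.getD_eq_true {n : ℕ} {b : List Bool} (h : IsNBlock n b) {d : ℕ}
    (hd : b.getD d false = true) : d = 0 := by
  rw [h.2] at hd
  cases d with
  | zero => rfl
  | succ d =>
    simp [List.getD_eq_getElem?_getD, List.getElem?_replicate] at hd
    split_ifs at hd <;> simp at hd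

/-- A true entry of a concatenation of `n`-blocks starts an `n`-block, which is paired with a
word `r` at the same place in the refinement. -/
theorem exists_block_at {n : ℕ} {Q : List Bool → Prop} {bls rs : List (List Bool)}
    (hb : ∀ b ∈ bls, IsNBlock n b) (hl : bls.length = rs.length)
    (hr : ∀ pr ∈ List.zip bls rs, pr.2.length = pr.1.length ∧ Q pr.2) {a : ℕ}
    (ha : bls.flatten.getD a false = true) :
    ∃ r, Q r ∧ n + 2 ≤ r.length ∧ a + r.length ≤ bls.flatten.length ∧
      (∀ d, 0 < d → d < r.length → bls.flatten.getD (a + d) false = false) ∧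
      ∀ d, d < r.length → rs.flatten.getD (a + d) false = r.getD d false := by
  induction bls generalizing rs a with
  | nil => simp at ha
  | cons b bls ih =>
    obtain _ | ⟨r, rs⟩ := rs
    · simp at hl
    obtain ⟨hrl, hQ⟩ := hr (b, r) (by simp)
    have hbb := hb b (by simp)
    simp only at hrl hQ
    rw [List.flatten_cons] at ha ⊢
    rw [List.flatten_cons, List.length_append]
    rcases lt_or_ge a b.length with h | h
    · rw [List.getD_append _ _ _ _ h] at ha
      have ha0 := hbb.getD_eq_true ha
      subst ha0
      refine ⟨r, hQ, hrl ▸ hbb.1, by omega, fun d h1 h2 => ?_, fun d h1 => ?_⟩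
      · rw [zero_add, List.getD_append _ _ _ _ (by omega)]
        by_contra hc
        have := hbb.getD_eq_true (by simpa using hc)
        omega
      · rw [zero_add, List.getD_append _ _ _ _ h1]
    · rw [List.getD_append_right _ _ _ _ h] at ha
      obtain ⟨r', h1, h2, h3, h4, h5⟩ := ih (fun c hc => hb c (by simp [hc])) (by simpa using hl)
        (fun pr hpr => hr pr (by simp [hpr])) ha
      refine ⟨r', h1, h2, by omega, fun d g1 g2 => ?_, fun d g1 => ?_⟩
      · rw [List.getD_append_right _ _ _ _ (by omega),
          show a + d - b.length = a - b.length + d by omega]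
        exact h4 d g1 g2
      · rw [List.getD_append_right _ _ _ _ (by omega), hrl,
          show a + d - b.length = a - b.length + d by omega]
        exact h5 d g1

section Fractal

variable {n ℓ : ℕ} {w : ℕ → List Bool}

theorem length_joinUpTo (hf : FractalReq n ℓ w) {k : ℕ} (h1 : 1 ≤ k) (hk : k ≤ n) :
    (joinUpTo w k).length = ℓ := by
  induction k, h1 using Nat.le_induction with
  | base => exact hf.1 1 le_rfl hk
  | succ k h1 ih =>
    obtain ⟨k, rfl⟩ : ∃ m, k = m + 1 := ⟨k - 1, by omega⟩
    simp only [joinUpTo, join2, List.length_zipWith, ih (by omega), hf.1 (k + 2) (by omega) hk]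
    simp

theorem getD_joinUpTo (hf : FractalReq n ℓ w) {k : ℕ} (h1 : 1 ≤ k) (hk : k ≤ n) (a : ℕ) :
    (joinUpTo w k).getD a false = true ↔
      ∃ k', 1 ≤ k' ∧ k' ≤ k ∧ (w k').getD a false = true := by
  induction k, h1 using Nat.le_induction with
  | base =>
    exact ⟨fun h => ⟨1, le_rfl, le_rfl, h⟩, fun ⟨k', h1, h2, h⟩ => by
      obtain rfl : k' = 1 := by omega
      exact h⟩
  | succ k h1 ih =>
    have hl := length_joinUpTo hf h1 (by omega)
    have hw := hf.1 (k + 1) (by omega) hk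
    have key : (joinUpTo w (k + 1)).getD a false =
        ((joinUpTo w k).getD a false || (w (k + 1)).getD a false) := by
      obtain ⟨k, rfl⟩ : ∃ m, k = m + 1 := ⟨k - 1, by omega⟩
      rcases lt_or_ge a ℓ with ha | ha
      · simp [joinUpTo, join2, List.getD_eq_getElem?_getD, List.getElem?_zipWith,
          List.getElem?_eq_getElem (hl.symm ▸ ha : a < (joinUpTo w (k + 1)).length),
          List.getElem?_eq_getElem (hw.symm ▸ ha : a < (w (k + 2)).length)]
      · have := length_joinUpTo hf (show 1 ≤ k + 1 + 1 by omega) hk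
        rw [List.getD_eq_default _ _ (by omega), List.getD_eq_default _ _ (by omega),
          List.getD_eq_default _ _ (by omega)]
        rfl
    rw [key, Bool.or_eq_true, ih (by omega)]
    constructor
    · rintro (⟨k', h1, h2, h⟩ | h)
      · exact ⟨k', h1, by omega, h⟩
      · exact ⟨k + 1, by omega, le_rfl, h⟩
    · rintro ⟨k', h1, h2, h⟩
      rcases h2.eq_or_lt with rfl | h3
      · exact Or.inr h
      · exact Or.inl ⟨k', h1, by omega, h⟩

theorem not_labW_succ (hf : FractalReq n ℓ w) {k : ℕ} (h1 : 1 ≤ k) (hk : k < n) {i : ℕ}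
    (h : (joinUpTo w k).getD (i - 1) false = true) : ¬ LabW w (k + 1) i := by
  obtain ⟨bls, rs, hb, hj, hw, hl, hr⟩ := hf.2.2.2 k h1 hk
  have hlj := length_joinUpTo hf h1 hk.le
  have hlw := hf.1 (k + 1) (by omega) hk
  rw [hj] at h hlj
  rw [hw] at hlw
  simp only [List.length_append, List.length_singleton] at hlj hlw
  unfold LabW
  rw [hw, Bool.not_eq_true]
  rcases lt_or_ge (i - 1) bls.flatten.length with ha | ha
  · rw [List.getD_append _ _ _ _ ha] at h
    obtain ⟨r, g1, g2, -, -, g5⟩ := exists_block_at hb hl hr h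
    rw [List.getD_append _ _ _ _ (by omega)]
    exact (g5 0 (by omega)).trans g1.getD_zero
  · rw [List.getD_append_right _ _ _ _ (by omega)]
    cases i - 1 - rs.flatten.length <;> simp

theorem HasType.unique (hf : FractalReq n ℓ w) {i k k' : ℕ} (h : HasType n ℓ w i k)
    (h' : HasType n ℓ w i k') : k = k' := by
  wlog hlt : k < k' generalizing k k'
  · rcases lt_trichotomy k k' with g | g | g
    · exact this h h' g
    · exact g
    · exact (this h' h g).symm
  obtain ⟨m, rfl⟩ : ∃ m, k' = m + 1 := ⟨k' - 1, by omega⟩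
  exact absurd h'.2.2.2 (not_labW_succ hf (by have := h.2.1; omega) h'.2.2.1
    ((getD_joinUpTo hf (by have := h.2.1; omega) (by have := h'.2.2.1; omega) _).2
      ⟨k, h.2.1, by omega, h.2.2.2⟩))

theorem hasType_last (hn : 1 ≤ n) (hl : 1 ≤ ℓ) (hf : FractalReq n ℓ w) :
    HasType n ℓ w ℓ 1 := by
  obtain ⟨bls, -, hj⟩ := hf.2.1 1 le_rfl hn
  refine ⟨⟨hl, le_rfl⟩, le_rfl, hn, ?_⟩
  have := length_joinUpTo hf le_rfl hn
  unfold LabW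
  change (joinUpTo w 1).getD _ _ = _
  rw [hj] at this ⊢
  simp only [List.length_append, List.length_singleton] at this
  rw [List.getD_append_right _ _ _ _ (by omega), show ℓ - 1 - bls.flatten.length = 0 by omega]
  simp

theorem IsAlert.hasType {ia : ℕ} (hn : 1 ≤ n) (h : IsAlert ℓ (w 1) ia) :
    HasType n ℓ w ia 1 := ⟨⟨h.1, h.2.1⟩, le_rfl, hn, h.2.2.1⟩

theorem IsAlert.ne_last {ia : ℕ} (hn : 1 ≤ n) (hf : FractalReq n ℓ w)
    (h : IsAlert ℓ (w 1) ia) : ia ≠ ℓ := by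
  rintro rfl
  obtain ⟨bls, hb, hj, hlen⟩ := hf.2.2.1
  have hl := length_joinUpTo hf le_rfl hn
  have hc := h.2.2.2
  change w 1 = _ at hj
  change (w 1).length = _ at hl
  rw [hj] at hl hc
  simp only [List.length_append, List.length_singleton] at hl
  have h1 := length_le_count_flatten hb
  rw [← card_filter_range_getD, ← Finset.card_map (addRightEmbedding 1)] at h1
  have h2 := Finset.card_le_card (s := Finset.map (addRightEmbedding 1)
    ((Finset.range bls.flatten.length).filter (fun d => bls.flatten.getD d false = true)))
    (t := (Finset.Icc 1 ia).filter
      (fun i => i < ia ∧ (bls.flatten ++ [true]).getD (i - 1) false = true)) (by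
    intro z hz
    simp only [Finset.mem_map, Finset.mem_filter, Finset.mem_range, addRightEmbedding_apply]
      at hz
    obtain ⟨d, ⟨hd, hd'⟩, rfl⟩ := hz
    simp only [Finset.mem_filter, Finset.mem_Icc, Nat.add_sub_cancel]
    refine ⟨⟨by omega, by omega⟩, by omega, ?_⟩
    rw [List.getD_append _ _ _ _ hd]
    exact hd')
  omega

variable {ia h : ℕ}

theorem exists_hType_iff {i : ℕ} : (∃ k, HType n ℓ w ia h i k) ↔ PPos n ℓ w i := by
  constructor
  · rintro ⟨k, ⟨-, -, hp, -⟩ | ⟨-, ht⟩⟩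
    · exact hp
    · exact ⟨k, ht⟩
  · intro hp
    by_cases hc : h ≠ 1 ∧ i = ia
    · exact ⟨h, Or.inl ⟨hc.1, hc.2, hp, rfl⟩⟩
    · obtain ⟨k, hk⟩ := hp
      exact ⟨k, Or.inr ⟨hc, hk⟩⟩

theorem hType_one_iff {i k : ℕ} : HType n ℓ w ia 1 i k ↔ HasType n ℓ w i k := by
  simp [HType]

theorem HType.unique (hf : FractalReq n ℓ w) {i k k' : ℕ} (hk : HType n ℓ w ia h i k)
    (hk' : HType n ℓ w ia h i k') : k = k' := by
  rcases hk with ⟨a, b, -, c⟩ | ⟨a, b⟩ <;> rcases hk' with ⟨a', b', -, c'⟩ | ⟨a', b'⟩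
  · exact c.trans c'.symm
  · exact absurd ⟨a, b⟩ a'
  · exact absurd ⟨a', b'⟩ a
  · exact b.unique hf b'

theorem HType.bounds (h1 : 1 ≤ h) (hn : h ≤ n) {i k : ℕ} (hk : HType n ℓ w ia h i k) :
    1 ≤ i ∧ i ≤ ℓ ∧ 1 ≤ k ∧ k ≤ n := by
  rcases hk with ⟨-, -, ⟨r, hr⟩, rfl⟩ | ⟨-, hr⟩
  · exact ⟨hr.1.1, hr.1.2, h1, hn⟩
  · exact ⟨hr.1.1, hr.1.2, hr.2.1, hr.2.2.1⟩

open Classical in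
/-- The index of the `h`-type of a main `p`-position, and `n + 1` at other positions. -/
noncomputable def typeRank (n ℓ : ℕ) (w : ℕ → List Bool) (ia h i : ℕ) : ℕ :=
  if H : ∃ k, HType n ℓ w ia h i k then H.choose else n + 1

theorem typeRank_of_not_pPos {i : ℕ} (hi : ¬ PPos n ℓ w i) : typeRank n ℓ w ia h i = n + 1 :=
  dif_neg (mt exists_hType_iff.1 hi)

theorem HType.typeRank_eq (hf : FractalReq n ℓ w) {i k : ℕ} (hk : HType n ℓ w ia h i k) :
    typeRank n ℓ w ia h i = k := by
  have H : ∃ k, HType n ℓ w ia h i k := ⟨k, hk⟩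
  rw [typeRank, dif_pos H]
  exact H.choose_spec.unique hf hk

theorem hType_iff_typeRank (h1 : 1 ≤ h) (hn : h ≤ n) (hf : FractalReq n ℓ w) {i k : ℕ} :
    HType n ℓ w ia h i k ↔ typeRank n ℓ w ia h i = k ∧ k ≤ n := by
  constructor
  · exact fun hk => ⟨hk.typeRank_eq hf, (hk.bounds h1 hn).2.2.2⟩
  · rintro ⟨rfl, hle⟩
    by_cases hp : PPos n ℓ w i
    · obtain ⟨k, hk⟩ := exists_hType_iff (ia := ia) (h := h) |>.2 hp
      rwa [hk.typeRank_eq hf]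
    · rw [typeRank_of_not_pPos hp] at hle
      omega

theorem pPos_iff_typeRank (h1 : 1 ≤ h) (hn : h ≤ n) (hf : FractalReq n ℓ w) {i : ℕ} :
    PPos n ℓ w i ↔ typeRank n ℓ w ia h i ≤ n := by
  rw [← exists_hType_iff (ia := ia) (h := h)]
  exact ⟨fun ⟨k, hk⟩ => hk.typeRank_eq hf ▸ (hk.bounds h1 hn).2.2.2,
    fun hle => ⟨_, (hType_iff_typeRank h1 hn hf).2 ⟨rfl, hle⟩⟩⟩

theorem typeRank_le (h1 : 1 ≤ h) (hn : h ≤ n) (hf : FractalReq n ℓ w) (i : ℕ) :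
    typeRank n ℓ w ia h i ≤ n + 1 := by
  by_cases hp : PPos n ℓ w i
  · have := (pPos_iff_typeRank (ia := ia) h1 hn hf).1 hp
    omega
  · exact (typeRank_of_not_pPos hp).le

theorem one_le_typeRank (h1 : 1 ≤ h) (hn : h ≤ n) (hf : FractalReq n ℓ w) (i : ℕ) :
    1 ≤ typeRank n ℓ w ia h i := by
  by_cases hp : PPos n ℓ w i
  · obtain ⟨k, hk⟩ := exists_hType_iff (ia := ia) (h := h) |>.2 hp
    rw [hk.typeRank_eq hf]
    exact (hk.bounds h1 hn).2.2.1
  · rw [typeRank_of_not_pPos hp]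
    omega

theorem typeRank_eq_or (hn : 1 ≤ n) (hf : FractalReq n ℓ w) (ha : IsAlert ℓ (w 1) ia) (i : ℕ) :
    typeRank n ℓ w ia h i = typeRank n ℓ w ia 1 i ∨ typeRank n ℓ w ia 1 i = 1 := by
  by_cases hi : i = ia
  · subst hi
    exact Or.inr ((hType_one_iff.2 (ha.hasType hn)).typeRank_eq hf)
  · left
    by_cases hp : PPos n ℓ w i
    · obtain ⟨k, hk⟩ := hp
      rw [HType.typeRank_eq hf (hType_one_iff.2 hk),
        HType.typeRank_eq hf (Or.inr ⟨fun hc => hi hc.2, hk⟩)]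
    · rw [typeRank_of_not_pPos hp, typeRank_of_not_pPos hp]

theorem joinUpTo_of_typeRank_le (hf : FractalReq n ℓ w) {k i : ℕ} (h1 : 1 ≤ k) (hk : k ≤ n)
    (hi : typeRank n ℓ w ia 1 i ≤ k) :
    1 ≤ i ∧ (joinUpTo w k).getD (i - 1) false = true := by
  obtain ⟨hm, g1, g2, g3⟩ := hType_one_iff.1 ((hType_iff_typeRank (ia := ia) (i := i)
    le_rfl (h1.trans hk) hf).2 ⟨rfl, hi.trans hk⟩)
  exact ⟨hm.1, (getD_joinUpTo hf h1 hk _).2 ⟨_, g1, hi, g3⟩⟩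

theorem le_rankCount_typeRank_one (hn : 1 ≤ n) (hf : FractalReq n ℓ w) {x q : ℕ} (hx : x < ℓ)
    (hxq : typeRank n ℓ w ia 1 x < q) (hq : q ≤ n + 1) :
    n + 1 ≤ rankCount (typeRank n ℓ w ia 1) ℓ q (x + 1) := by
  obtain ⟨k, rfl⟩ : ∃ k, q = k + 1 := ⟨q - 1, by omega⟩
  have hk1 : 1 ≤ k := by
    have := one_le_typeRank (ia := ia) le_rfl hn hf x
    omega
  obtain ⟨hx1, hJ⟩ := joinUpTo_of_typeRank_le (ia := ia) (i := x) hf hk1 (by omega) (by omega)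
  have hlj := length_joinUpTo hf hk1 (by omega)
  have low : ∀ z, 1 ≤ z → (joinUpTo w k).getD (z - 1) false = false →
      k + 1 ≤ typeRank n ℓ w ia 1 z := by
    intro z hz hz'
    by_contra hc
    have := (joinUpTo_of_typeRank_le (ia := ia) (i := z) hf hk1 (by omega) (by omega)).2
    rw [hz'] at this
    exact Bool.noConfusion this
  rcases hq.lt_or_eq with hq | hq
  · obtain ⟨bls, rs, hb, hj, hw, hl, hr⟩ := hf.2.2.2 k hk1 (by omega)
    have hlw := hf.1 (k + 1) (by omega) (by omega)
    rw [hj] at hJ hlj low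
    rw [hw] at hlw
    simp only [List.length_append, List.length_singleton] at hlj hlw
    rw [List.getD_append _ _ _ _ (by omega)] at hJ
    obtain ⟨r, g1, g2, g3, g4, g5⟩ := exists_block_at hb hl hr hJ
    refine le_trans ?_ (card_le_rankCount (e := x + r.length) (by omega) fun z hz1 hz2 => ?_)
    · refine le_trans (show n + 1 ≤ r.count true by have := g1.le_count; omega) ?_
      rw [← card_filter_range_getD, ← Finset.card_map (addRightEmbedding x)]
      refine Finset.card_le_card fun z hz => ?_
      simp only [Finset.mem_map, Finset.mem_filter, Finset.mem_range, addRightEmbedding_apply]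
        at hz
      obtain ⟨d, ⟨hd, hd'⟩, rfl⟩ := hz
      have hd0 : d ≠ 0 := by
        rintro rfl
        rw [g1.getD_zero] at hd'
        exact Bool.noConfusion hd'
      simp only [Finset.mem_filter, Finset.mem_Ico]
      refine ⟨⟨by omega, by omega⟩, HType.typeRank_eq hf (hType_one_iff.2
        ⟨⟨by omega, by omega⟩, by omega, by omega, ?_⟩)⟩
      unfold LabW
      rw [hw, List.getD_append _ _ _ _ (by omega), show d + x - 1 = x - 1 + d by omega, g5 d hd]
      exact hd'
    · refine low z (by omega) ?_
      rw [List.getD_append _ _ _ _ (by omega),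
        show z - 1 = x - 1 + (z - x) by omega]
      exact g4 _ (by omega) (by omega)
  · obtain rfl : k = n := by omega
    obtain ⟨bls, hb, hj⟩ := hf.2.1 k hk1 le_rfl
    rw [hj] at hJ hlj low
    simp only [List.length_append, List.length_singleton] at hlj
    rw [List.getD_append _ _ _ _ (by omega)] at hJ
    obtain ⟨r, -, g2, g3, g4, -⟩ := exists_block_at (Q := fun _ => True) (rs := bls) hb rfl
      (fun pr hpr => by
        rw [List.zip, List.zipWith_self] at hpr
        obtain ⟨b, -, rfl⟩ := List.mem_map.1 hpr
        exact ⟨rfl, trivial⟩) hJ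
    have hz : ∀ z, x + 1 ≤ z → z < x + r.length → k + 1 ≤ typeRank k ℓ w ia 1 z := by
      intro z hz1 hz2
      refine low z (by omega) ?_
      rw [List.getD_append _ _ _ _ (by omega),
        show z - 1 = x - 1 + (z - x) by omega]
      exact g4 _ (by omega) (by omega)
    refine le_trans ?_ (card_le_rankCount (e := x + r.length) (by omega) hz)
    rw [Finset.filter_true_of_mem fun z hz' => ?_, Nat.card_Ico]
    · omega
    · rw [Finset.mem_Ico] at hz'
      exact le_antisymm (typeRank_le le_rfl hn hf z) (hz z hz'.1 hz'.2)

theorem fractalRank_typeRank (hl : 1 ≤ ℓ) (h1 : 1 ≤ h) (hn : h ≤ n) (hf : FractalReq n ℓ w)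
    (ha : IsAlert ℓ (w 1) ia) : FractalRank n ℓ (typeRank n ℓ w ia h) where
  one_le := one_le_typeRank h1 hn hf
  le := typeRank_le h1 hn hf
  rank_last := HType.typeRank_eq hf
    (Or.inr ⟨fun hc => ha.ne_last (h1.trans hn) hf hc.2.symm, hasType_last (h1.trans hn) hl hf⟩)
  rank_of_gt x hx := typeRank_of_not_pPos fun ⟨_, hk⟩ => by
    have := hk.1.2
    omega
  large x q hx hxq hq := by
    have hor := typeRank_eq_or (h := h) (h1.trans hn) hf ha
    have h1x := one_le_typeRank (ia := ia) h1 hn hf x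
    refine (le_rankCount_typeRank_one (ia := ia) (h1.trans hn) hf hx ?_ hq).trans
      (rankCount_mono_of_raise (by omega) hor)
    have := hor x
    omega

theorem MacroBlock.rankCount_eq (h1 : 1 ≤ h) (hn : h ≤ n) (hf : FractalReq n ℓ w) {i j k : ℕ}
    (hk : HType n ℓ w ia h i k) (hb : MacroBlock n ℓ w ia h i j) :
    HType n ℓ w ia h j k ∧ rankCount (typeRank n ℓ w ia h) ℓ k i =
      rankCount (typeRank n ℓ w ia h) ℓ k j + 1 := by
  obtain ⟨hij, k', hi, hj, hb⟩ := hb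
  obtain rfl := hk.unique hf hi
  refine ⟨hj, ?_⟩
  rw [rankCount_self (hi.bounds h1 hn).2.1 (hi.typeRank_eq hf),
    rankCount_eq_of_forall_lt (y := j) (by omega) fun z hz1 hz2 => ?_]
  by_contra hc
  have hz := (hType_iff_typeRank (ia := ia) (i := z) h1 hn hf).2
    ⟨rfl, by have := (hi.bounds h1 hn).2.2.2; omega⟩
  exact hc (hb z _ hz1 hz2 hz)

theorem rankCount_of_not_macroBlock (h1 : 1 ≤ h) (hn : h ≤ n) (hf : FractalReq n ℓ w)
    {i k : ℕ} (hk : HType n ℓ w ia h i k) (hb : ¬ ∃ j, MacroBlock n ℓ w ia h i j) :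
    rankCount (typeRank n ℓ w ia h) ℓ k i = 1 := by
  rw [rankCount_self (hk.bounds h1 hn).2.1 (hk.typeRank_eq hf)]
  by_contra hc
  obtain ⟨j, g1, -, g3, g4⟩ := exists_next_of_rankCount_pos
    (show 0 < rankCount (typeRank n ℓ w ia h) ℓ k (i + 1) by omega)
  exact hb ⟨j, g1, k, hk,
    (hType_iff_typeRank h1 hn hf).2 ⟨g3, (hk.bounds h1 hn).2.2.2⟩,
    fun z r hz1 hz2 hr => hr.typeRank_eq hf ▸ g4 z hz1 hz2⟩

theorem POrder.rankCount_eq (h1 : 1 ≤ h) (hn : h ≤ n) (hf : FractalReq n ℓ w) {i k o : ℕ}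
    (hk : HType n ℓ w ia h i k) (ho : POrder n ℓ w ia h i o) :
    rankCount (typeRank n ℓ w ia h) ℓ k i = o + 1 := by
  rcases ho with ⟨rfl, hb⟩ | ⟨j, -, c, rfl, -, hc, hlast⟩
  · exact rankCount_of_not_macroBlock h1 hn hf hk hb
  · have key : ∀ s ≤ o, HType n ℓ w ia h (c s) k ∧
        rankCount (typeRank n ℓ w ia h) ℓ k (c 0) =
          rankCount (typeRank n ℓ w ia h) ℓ k (c s) + s := by
      intro s
      induction s with
      | zero => exact fun _ => ⟨hk, rfl⟩
      | succ s ih =>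
        intro hs
        obtain ⟨g1, g2⟩ := ih (by omega)
        obtain ⟨g3, g4⟩ := (hc s hs).rankCount_eq h1 hn hf g1
        exact ⟨g3, by omega⟩
    obtain ⟨g1, g2⟩ := key o le_rfl
    have := rankCount_of_not_macroBlock h1 hn hf g1 hlast
    omega

theorem LowAnc.rankCount_eq (h1 : 1 ≤ h) (hn : h ≤ n) (hf : FractalReq n ℓ w) {i k a q : ℕ}
    (hk : HType n ℓ w ia h i k) (ha : LowAnc n ℓ w ia h i a) (hq : q < k) :
    rankCount (typeRank n ℓ w ia h) ℓ q i = rankCount (typeRank n ℓ w ia h) ℓ q a := by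
  obtain ⟨k', hi, hia, -, hmin⟩ := ha
  obtain rfl := hk.unique hf hi
  refine rankCount_eq_of_forall_lt hia.le fun z hz1 hz2 => hq.trans_le ?_
  rcases hz1.eq_or_lt with rfl | hz
  · exact (hk.typeRank_eq hf).ge
  · by_contra hc
    have := hmin z _ hz ((hType_iff_typeRank (ia := ia) h1 hn hf).2
      ⟨rfl, by have := (hi.bounds h1 hn).2.2.2; omega⟩) (not_le.1 hc)
    omega

theorem OrdCond.min_rankCount_eq (h1 : 1 ≤ h) (hn : h ≤ n) (hf : FractalReq n ℓ w)
    {i j k m : ℕ} (hi : HType n ℓ w ia h i k) (hj : HType n ℓ w ia h j k)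
    (ho : OrdCond n ℓ w ia h m i j) :
    min (rankCount (typeRank n ℓ w ia h) ℓ k i) (m + 1) =
      min (rankCount (typeRank n ℓ w ia h) ℓ k j) (m + 1) := by
  obtain ⟨oi, oj, g1, g2, g3⟩ := ho
  rw [g1.rankCount_eq h1 hn hf hi, g2.rankCount_eq h1 hn hf hj]
  omega

theorem PComp.rankClass_eq (hl : 1 ≤ ℓ) (h1 : 1 ≤ h) (hn : h ≤ n) (hf : FractalReq n ℓ w)
    (ha : IsAlert ℓ (w 1) ia) {i j m : ℕ} (hc : PComp n ℓ w ia h m i j) :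
    rankClass (typeRank n ℓ w ia h) ℓ m i = rankClass (typeRank n ℓ w ia h) ℓ m j := by
  have F := fractalRank_typeRank hl h1 hn hf ha
  induction hc with
  | base i j hi hj ho =>
    funext q
    unfold rankClass
    rcases lt_trichotomy q 1 with hq | rfl | hq
    · obtain rfl : q = 0 := by omega
      rw [F.rankCount_zero, F.rankCount_zero]
    · exact ho.min_rankCount_eq h1 hn hf hi hj
    · rw [rankCount_of_rank_lt (by rwa [hi.typeRank_eq hf]),
        rankCount_of_rank_lt (by rwa [hj.typeRank_eq hf])]
  | step i j k ai aj hi hj ho hai haj _ ih =>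
    funext q
    have ihq := congrFun ih q
    unfold rankClass at *
    rcases lt_trichotomy q k with hq | rfl | hq
    · rwa [hai.rankCount_eq h1 hn hf hi hq, haj.rankCount_eq h1 hn hf hj hq]
    · exact ho.min_rankCount_eq h1 hn hf hi hj
    · rw [rankCount_of_rank_lt (by rwa [hi.typeRank_eq hf]),
        rankCount_of_rank_lt (by rwa [hj.typeRank_eq hf])]

theorem PAfter.typeRank_of_lt {i j z : ℕ} (hp : PAfter n ℓ w i j) (hz1 : i ≤ z) (hz2 : z < j) :
    typeRank n ℓ w ia h z = n + 1 :=
  typeRank_of_not_pPos fun hc => by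
    have := hp.2.2 z hc hz1
    omega

theorem PAfter.rankCount_max (h1 : 1 ≤ h) (hn : h ≤ n) (hf : FractalReq n ℓ w) {i j : ℕ}
    (hp : PAfter n ℓ w i j) : rankCount (typeRank n ℓ w ia h) ℓ (n + 1) i = j - i := by
  have hj := (pPos_iff_typeRank (ia := ia) h1 hn hf).1 hp.1
  have hjl : j ≤ ℓ := by
    obtain ⟨k, hk⟩ := hp.1
    exact hk.1.2
  induction hd : j - i generalizing i with
  | zero =>
    have := hp.2.1
    exact rankCount_of_rank_lt (by rw [show i = j by omega]; omega)
  | succ d ih =>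
    rw [rankCount_self (by omega) (hp.typeRank_of_lt le_rfl (by omega)),
      ih ⟨hp.1, by omega, fun z hz hz' => hp.2.2 z hz (by omega)⟩ (by omega)]

theorem RPos.rankClass_eq (hl : 1 ≤ ℓ) (h1 : 1 ≤ h) (hn : h ≤ n) (hf : FractalReq n ℓ w)
    (ha : IsAlert ℓ (w 1) ia) {i j m : ℕ} (hr : RPos n ℓ w ia h m i j) :
    rankClass (typeRank n ℓ w ia h) ℓ m i = rankClass (typeRank n ℓ w ia h) ℓ m j := by
  have F := fractalRank_typeRank hl h1 hn hf ha
  rcases hr with ⟨-, -, hc⟩ | ⟨-, -, pi, pj, hi, hj, hc, hd⟩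
  · exact hc.rankClass_eq hl h1 hn hf ha
  · funext q
    have hq := congrFun (hc.rankClass_eq hl h1 hn hf ha) q
    unfold rankClass at *
    rcases lt_trichotomy q (n + 1) with hqn | rfl | hqn
    · rwa [rankCount_eq_of_forall_lt hi.2.1 fun z hz1 hz2 =>
          by rwa [hi.typeRank_of_lt hz1 hz2],
        rankCount_eq_of_forall_lt hj.2.1 fun z hz1 hz2 =>
          by rwa [hj.typeRank_of_lt hz1 hz2]]
    · rw [hi.rankCount_max h1 hn hf, hj.rankCount_max h1 hn hf]
      omega
    · rw [F.rankCount_of_gt_max hqn, F.rankCount_of_gt_max hqn]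

end Fractal

theorem TreeKripke.TInit.length {AP : Type} {T : TreeKripke AP} {pa : ℕ → List ℕ}
    (h : T.TInit pa) (i : ℕ) : (pa i).length = i := by
  induction i with
  | zero => simp [h.1]
  | succ i ih =>
    obtain ⟨a, ha⟩ := T.edge_child (h.2 i)
    simp [ha, ih]

theorem TreeKripke.TInit.take_one {AP : Type} {T : TreeKripke AP} {pa : ℕ → List ℕ}
    (h : T.TInit pa) {i : ℕ} (hi : 1 ≤ i) : (pa i).take 1 = pa 1 := by
  induction i, hi using Nat.le_induction with
  | base => exact List.take_of_length_le (h.length 1).le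
  | succ i hi ih =>
    obtain ⟨a, ha⟩ := T.edge_child (h.2 i)
    rw [ha, List.take_append_of_le_length (by rw [h.length]; exact hi), ih]

namespace KLTLKnData

variable {n ℓ : ℕ} {T : TreeKripke Unit} (D : KLTLKnData n T ℓ)
include D

theorem eq_pEta_or_pXi {pa : ℕ → List ℕ} (h : T.TInit pa) :
    pa = D.pEta ∨ ∃ k, 1 ≤ k ∧ k ≤ n ∧ pa = D.pXi k := by
  have h1 := h.2 0
  rw [h.1] at h1
  rcases D.succ_only _ h1 with h2 | ⟨k, hk1, hk2, h2⟩
  · exact Or.inl (D.pEta_unique pa h ⟨_, h2⟩)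
  · exact Or.inr ⟨k, hk1, hk2, D.pXi_unique k hk1 hk2 pa h ⟨_, h2⟩⟩

theorem eq_of_apply_one_eq {pa pb : ℕ → List ℕ} (ha : T.TInit pa) (hb : T.TInit pb)
    (h : pa 1 = pb 1) : pa = pb := by
  have h1 := ha.2 0
  rw [ha.1] at h1
  rcases D.succ_only _ h1 with h2 | ⟨k, hk1, hk2, h2⟩
  · rw [D.pEta_unique pa ha ⟨_, h2⟩, D.pEta_unique pb hb ⟨1, h ▸ h2⟩]
  · rw [D.pXi_unique k hk1 hk2 pa ha ⟨_, h2⟩, D.pXi_unique k hk1 hk2 pb hb ⟨1, h ▸ h2⟩]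

theorem eq_of_apply_eq {pa pb : ℕ → List ℕ} (ha : T.TInit pa) (hb : T.TInit pb) {i j : ℕ}
    (hi : 1 ≤ i) (h : pa i = pb j) : i = j ∧ pa = pb := by
  have hij : i = j := by rw [← ha.length i, h, hb.length j]
  subst hij
  exact ⟨rfl, D.eq_of_apply_one_eq ha hb (by rw [← ha.take_one hi, h, hb.take_one hi])⟩

theorem pEta_ne_pXi {k : ℕ} (h1 : 1 ≤ k) (hk : k ≤ n) : D.pEta ≠ D.pXi k := by
  intro h
  obtain ⟨i, hi⟩ := D.pEta_visits
  obtain ⟨j, hj⟩ := D.pXi_visits k h1 hk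
  obtain ⟨a, ha⟩ := T.edge_child (D.edge_xi k h1 hk)
  obtain ⟨b, hb⟩ := T.edge_child D.edge_eta
  have e1 := D.pEta_init.length i
  have e2 := (D.pXi_init k h1 hk).length j
  rw [hi, hb] at e1
  rw [hj, ha] at e2
  refine D.eta_ne_xi k h1 hk ?_
  rw [← hi, ← hj, h, ← e1, ← e2]
  rfl

theorem mem_V_pXi {k i : ℕ} (h1 : 1 ≤ k) (hk : k ≤ n) (hi : 1 ≤ i) :
    () ∈ T.V (D.pXi k i) ↔ HasType n ℓ D.w i k := by
  rcases le_or_gt i ℓ with hl | hl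
  · rw [D.trace_xi₁ k h1 hk i hi hl]
    exact ⟨fun h => ⟨⟨hi, hl⟩, h1, hk, h⟩, fun h => h.2.2.2⟩
  · exact iff_of_false (D.trace_xi₂ k h1 hk i hl) fun h => by
      have := h.1.2
      omega

theorem mem_V_pEta (hn : 1 ≤ n) {i : ℕ} (hi : 1 ≤ i) :
    () ∈ T.V (D.pEta i) ↔ ¬ PPos n ℓ D.w i := by
  rcases le_or_gt i ℓ with hl | hl
  · have hlen := length_joinUpTo D.fractal hn le_rfl
    rw [D.trace_eta₁ i hi hl, D.w0_dual]
    have hiff : PPos n ℓ D.w i ↔ (joinUpTo D.w n).getD (i - 1) false = true := by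
      rw [getD_joinUpTo D.fractal hn le_rfl]
      exact ⟨fun ⟨k, h⟩ => ⟨k, h.2.1, h.2.2.1, h.2.2.2⟩,
        fun ⟨k, h1, h2, h3⟩ => ⟨k, ⟨hi, hl⟩, h1, h2, h3⟩⟩
    rw [hiff, List.getD_eq_getElem _ _ (by simp; omega), List.getD_eq_getElem _ _ (by omega)]
    simp
  · refine iff_of_true (D.trace_eta₂ i hl) fun ⟨k, h⟩ => ?_
    have := h.1.2
    omega

theorem exists_labels (hn : 1 ≤ n) {ia : ℕ} {pa : ℕ → List ℕ} (hpa : T.TInit pa) :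
    ∃ L : Set ℕ, ∀ i, 1 ≤ i → (() ∈ T.V (pa i) ↔ typeRank n ℓ D.w ia 1 i ∈ L) := by
  have hf := D.fractal
  rcases D.eq_pEta_or_pXi hpa with rfl | ⟨k, hk1, hk2, rfl⟩
  · refine ⟨{n + 1}, fun i hi => ?_⟩
    rw [D.mem_V_pEta hn hi, pPos_iff_typeRank (ia := ia) le_rfl hn hf, Set.mem_singleton_iff]
    have := typeRank_le (ia := ia) le_rfl hn hf i
    omega
  · refine ⟨{k}, fun i hi => ?_⟩
    rw [D.mem_V_pXi hk1 hk2 hi, ← hType_one_iff (ia := ia), hType_iff_typeRank le_rfl hn hf]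
    simp [hk2]

theorem exists_labels_alert {h ia : ℕ} (h2 : 2 ≤ h) (hn : h ≤ n) (ha : IsAlert ℓ (D.w 1) ia)
    {M : TreeKripke Unit} (hM : MObtainedKLTL M D ia) {pa : ℕ → List ℕ} (hpa : T.TInit pa)
    (hne : pa ≠ D.pXi h) :
    ∃ L : Set ℕ, ∀ i, 1 ≤ i → (() ∈ M.V (pa i) ↔ typeRank n ℓ D.w ia h i ∈ L) := by
  have hf := D.fractal
  have h1 : 1 ≤ h := by omega
  have hn1 : 1 ≤ n := by omega
  have hinit := D.pXi_init 1 le_rfl hn1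
  rcases D.eq_pEta_or_pXi hpa with rfl | ⟨k, hk1, hk2, rfl⟩
  · refine ⟨{n + 1}, fun i hi => ?_⟩
    rw [hM.2.2, if_neg fun hc => D.pEta_ne_pXi le_rfl hn1 (D.eq_of_apply_eq hpa hinit hi hc).2,
      D.mem_V_pEta hn1 hi, pPos_iff_typeRank (ia := ia) h1 hn hf, Set.mem_singleton_iff]
    have := typeRank_le (ia := ia) h1 hn hf i
    omega
  · have hkh : k ≠ h := fun hc => hne (by rw [hc])
    refine ⟨{k}, fun i hi => ?_⟩
    have hiff : typeRank n ℓ D.w ia h i ∈ ({k} : Set ℕ) ↔ i ≠ ia ∧ HasType n ℓ D.w i k := by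
      rw [Set.mem_singleton_iff, ← and_iff_left (a := _ = k) hk2,
        ← hType_iff_typeRank h1 hn hf, HType]
      have : h ≠ 1 := by omega
      simp [hkh, this]
    rw [hM.2.2, hiff]
    by_cases hc : D.pXi k i = D.pXi 1 ia
    · rw [if_pos hc]
      simp [(D.eq_of_apply_eq hpa hinit hi hc).1]
    · rw [if_neg hc, D.mem_V_pXi hk1 hk2 hi, iff_and_self]
      rintro ht rfl
      exact hc (by rw [ht.unique hf (ha.hasType hn1)])

end KLTLKnData

/-- **`(h*, |ψ|)`-compatible main positions are indistinguishable by HyperCTL\*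
formulas of size at most `n`**: (1) for `h* = 1`, on `K_n`, for every path
assignment; (2) for `h* ∈ [2, n]`, on `M_n`, for every path assignment whose image
does not contain `π(ξ_{h*})`. -/
theorem positions_indistinguishable (Var : Type) [DecidableEq Var] :
    ∀ n : ℕ, 1 < n → ∀ T : TreeKripke Unit, IsRegularTree T →
      ∀ ℓ : ℕ, 1 < ℓ → ∀ D : KLTLKnData n T ℓ,
        ∀ ia : ℕ, IsAlert ℓ (D.w 1) ia →
          ∀ M : TreeKripke Unit, MObtainedKLTL M D ia →
            ∀ h, 1 ≤ h → h ≤ n →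
              ∀ ψ : HCTLs Unit Var, HCTLs.size ψ ≤ n →
                ∀ i j : ℕ, RPos n ℓ D.w ia h (HCTLs.size ψ) i j →
                  ((h = 1 →
                      ∀ A : Var → (ℕ → List ℕ), (∀ x, T.TInit (A x)) → ∀ x,
                        (HCTLs.satT T ψ A x i ↔ HCTLs.satT T ψ A x j)) ∧
                   (2 ≤ h →
                      ∀ A : Var → (ℕ → List ℕ), (∀ x, M.TInit (A x)) →
                        (∀ x, A x ≠ D.pXi h) → ∀ x,
                        (HCTLs.satT M ψ A x i ↔ HCTLs.satT M ψ A x j))) := by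
  intro n hn1 T _ ℓ hl D ia ha M hM h h1 hn ψ hψ i j hr
  have F := fractalRank_typeRank hl.le h1 hn D.fractal ha
  have hc := hr.rankClass_eq hl.le h1 hn D.fractal ha
  have main : ∀ x, RPos n ℓ D.w ia h x i j → 1 ≤ i ∧ 1 ≤ j := by
    rintro x (⟨⟨_, hi⟩, ⟨_, hj⟩, -⟩ | ⟨hi, hj, -⟩)
    · exact ⟨hi.1.1, hj.1.1⟩
    · exact ⟨hi.1.1, hj.1.1⟩
  obtain ⟨hi, hj⟩ := main _ hr
  refine ⟨?_, fun h2 A hA hne x => ?_⟩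
  · rintro rfl A hA x
    exact F.satT_iff (S := {pa | T.TInit pa})
      (fun pa hpa pb hpb i hi h => D.eq_of_apply_one_eq hpb hpa (h 1 hi)) (fun _ hpa => hpa)
      (fun pa hpa => D.exists_labels hn hpa) ψ hψ i j hi hj hc A hA x
  · have hTM : ∀ pa, M.TInit pa ↔ T.TInit pa := fun pa => by
      rw [TreeKripke.TInit, hM.2.1, TreeKripke.TInit]
    exact F.satT_iff (S := {pa | M.TInit pa ∧ pa ≠ D.pXi h})
      (fun pa hpa pb hpb i hi h =>
        D.eq_of_apply_one_eq ((hTM pb).1 hpb) ((hTM pa).1 hpa.1) (h 1 hi))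
      (fun _ hpa => hpa.1)
      (fun pa hpa => D.exists_labels_alert h2 hn ha hM ((hTM pa).1 hpa.1) hpa.2)
      ψ hψ i j hi hj hc A (fun x => ⟨hA x, hne x⟩) x
end
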